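/- arXiv:2308.04318 — 4 statements merged into one kernel-verified Lean document; each statement's English description precedes it below -/
import Mathlib

section
/- Fix ε ∈ (0,1) and an open set R ⊆ ℝ². Let F : R → ℝ be twice continuously differentiable with −ε⁻¹ < ∂_yF(z) < −ε for all z ∈ R, and suppose F satisfies equation (E) on R. Then F is real analytic on R, i.e., around every point of R it is given by a convergent power series in the two variables. -/
open Real Set MeasureTheory Filter
open scoped ENNReal

noncomputable section

/-- The partial derivative of `F : ℝ × ℝ → ℝ` in its first (time) variable. -/
def pdT (F : ℝ × ℝ → ℝ) : ℝ × ℝ → ℝ := fun z => deriv (fun s => F (s, z.2)) z.1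

/-- The partial derivative of `F : ℝ × ℝ → ℝ` in its second (space) variable. -/
def pdX (F : ℝ × ℝ → ℝ) : ℝ × ℝ → ℝ := fun z => deriv (fun s => F (z.1, s)) z.2

/-- The iterated partial derivative `∂_t^i ∂_x^j F`. -/
def pdIter (F : ℝ × ℝ → ℝ) (i j : ℕ) : ℝ × ℝ → ℝ := pdT^[i] (pdX^[j] F)

/-- The nonlinear second-order operator appearing in equation (B):
`(∂_x F)² ∂_t² F − 2 (∂_t F)(∂_x F) ∂_t∂_x F + ((∂_t F)² + π² (∂_x F)⁴) ∂_x² F`. -/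
def BExpr (F : ℝ × ℝ → ℝ) (z : ℝ × ℝ) : ℝ :=
  (pdX F z) ^ 2 * pdT (pdT F) z - 2 * pdT F z * pdX F z * pdT (pdX F) z +
    ((pdT F z) ^ 2 + π ^ 2 * (pdX F z) ^ 4) * pdX (pdX F) z

/-- `F` satisfies equation (B) on `Ω`. -/
def SatisfiesB (F : ℝ × ℝ → ℝ) (Ω : Set (ℝ × ℝ)) : Prop := ∀ z ∈ Ω, BExpr F z = 0

/-- `G` satisfies equation (E) on `R`:  `∂_y G ≠ 0` and
`∂_t² G + π² (∂_y G)⁻⁴ ∂_y² G = 0` at every point of `R`. -/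
def SatisfiesE (G : ℝ × ℝ → ℝ) (R : Set (ℝ × ℝ)) : Prop :=
  ∀ z ∈ R, pdX G z ≠ 0 ∧
    pdT (pdT G) z + π ^ 2 * ((pdX G z) ^ 4)⁻¹ * pdX (pdX G) z = 0

/-- Admissible functions on `R`: continuous on `closure R`, differentiable on `R`, with
strictly negative partial derivative in the second variable. -/
def Adm (F : ℝ × ℝ → ℝ) (R : Set (ℝ × ℝ)) : Prop :=
  ContinuousOn F (closure R) ∧ DifferentiableOn ℝ F R ∧ ∀ z ∈ R, pdX F z < 0

/-- `ε`-admissible functions on `R`: the partial derivative in the second variable lies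
strictly between `-ε⁻¹` and `-ε`. -/
def AdmE (ε : ℝ) (F : ℝ × ℝ → ℝ) (R : Set (ℝ × ℝ)) : Prop :=
  ContinuousOn F (closure R) ∧ DifferentiableOn ℝ F R ∧
    ∀ z ∈ R, -ε⁻¹ < pdX F z ∧ pdX F z < -ε

/-- The `C^m` norm `∑_{j=0}^m max_{i ≤ j} sup_{z ∈ R} |∂_t^i ∂_x^{j-i} F(z)|`,
valued in `ℝ≥0∞`. -/
def CmNorm (m : ℕ) (F : ℝ × ℝ → ℝ) (R : Set (ℝ × ℝ)) : ℝ≥0∞ :=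
  ∑ j ∈ Finset.range (m + 1),
    ⨆ i ∈ Finset.range (j + 1), ⨆ z ∈ R, ENNReal.ofReal |pdIter F i (j - i) z|

/-- The one-dimensional `C^m` norm `∑_{j=0}^m sup_{x ∈ S} |f^{(j)}(x)|`, valued in `ℝ≥0∞`. -/
def CmNorm1 (m : ℕ) (f : ℝ → ℝ) (S : Set ℝ) : ℝ≥0∞ :=
  ∑ j ∈ Finset.range (m + 1), ⨆ x ∈ S, ENNReal.ofReal |deriv^[j] f x|

/-- `R` has `C^k` boundary. -/
def HasCkBoundary (k : ℕ) (R : Set (ℝ × ℝ)) : Prop :=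
  ∀ z₀ ∈ frontier R, ∃ (r : ℝ) (ψ ψinv : ℝ × ℝ → ℝ × ℝ), 0 < r ∧
    Set.InjOn ψ (Metric.ball z₀ r) ∧
    (∀ w ∈ Metric.ball z₀ r ∩ R, 0 < (ψ w).1) ∧
    (∀ w ∈ Metric.ball z₀ r ∩ frontier R, (ψ w).1 = 0) ∧
    ContDiffOn ℝ k ψ (Metric.ball z₀ r) ∧
    ContDiffOn ℝ k ψinv (ψ '' (Metric.ball z₀ r ∩ R)) ∧
    ∀ w ∈ Metric.ball z₀ r, ψinv (ψ w) = w

/-- The set `𝔇_r = {z ∈ R : dist(z, ∂R ∖ ∂R') > r}`. -/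
def Dset (r : ℝ) (R R' : Set (ℝ × ℝ)) : Set (ℝ × ℝ) :=
  {z ∈ R | ENNReal.ofReal r < EMetric.infEdist z (frontier R \ frontier R')}

open scoped Topology ContDiff

/-- Inverse function theorem in finite dimension, for a map with injective derivative between
spaces of equal dimension. -/
lemma ContDiffAt.exists_local_inverse {E E' : Type*} [NormedAddCommGroup E] [NormedSpace ℝ E]
    [FiniteDimensional ℝ E] [NormedAddCommGroup E'] [NormedSpace ℝ E'] [FiniteDimensional ℝ E']
    {n : WithTop ℕ∞} {f : E → E'} {f' : E →L[ℝ] E'} {a : E} (hf : ContDiffAt ℝ n f a) (hn : n ≠ 0)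
    (hf' : HasFDerivAt f f' a) (hinj : ∀ v, f' v = 0 → v = 0)
    (hdim : Module.finrank ℝ E = Module.finrank ℝ E') :
    ∃ g : E' → E, ContDiffAt ℝ n g (f a) ∧ g (f a) = a ∧ (∀ᶠ x in 𝓝 a, g (f x) = x) ∧
      ∀ᶠ y in 𝓝 (f a), f (g y) = y := by
  have : CompleteSpace E := FiniteDimensional.complete ℝ E
  have hinj' : Function.Injective (f' : E →ₗ[ℝ] E') :=
    (injective_iff_map_eq_zero _).2 hinj
  let L : E ≃L[ℝ] E' :=
    (LinearMap.linearEquivOfInjective (f' : E →ₗ[ℝ] E') hinj' hdim).toContinuousLinearEquiv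
  have hL : (L : E →L[ℝ] E') = f' := by
    ext v
    rfl
  rw [← hL] at hf'
  have hs := hf.hasStrictFDerivAt' hf' hn
  exact ⟨hf.localInverse hf' hn, hf.to_localInverse hf' hn, hf.localInverse_apply_image hf' hn,
    hs.eventually_left_inverse, hs.eventually_right_inverse⟩

/-- If `ζ` is a local `C¹` coordinate and the differential of `w` is a complex multiple of that
of `ζ` at each point, then `w` is locally a holomorphic function of `ζ`. -/
lemma exists_holomorphic_factor {E : Type*} [NormedAddCommGroup E] [NormedSpace ℝ E]
    [FiniteDimensional ℝ E] (hdim : Module.finrank ℝ E = 2) {ζ w : E → ℂ} {a : E}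
    (hζ : ContDiffAt ℝ 1 ζ a) (hinj : ∀ v, fderiv ℝ ζ a v = 0 → v = 0)
    (hw : ContDiffAt ℝ 1 w a)
    (hfac : ∀ᶠ z in 𝓝 a, ∃ c : ℂ, ∀ v, fderiv ℝ w z v = c * fderiv ℝ ζ z v) :
    ∃ h : ℂ → ℂ, AnalyticAt ℂ h (ζ a) ∧ ∀ᶠ z in 𝓝 a, w z = h (ζ z) := by
  obtain ⟨g, hg, hga, hleft, hright⟩ := hζ.exists_local_inverse one_ne_zero
    (hζ.differentiableAt one_ne_zero).hasFDerivAt hinj (by rw [hdim, Complex.finrank_real_complex])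
  refine ⟨w ∘ g, ?_, hleft.mono fun z hz => by simp [hz]⟩
  rw [Complex.analyticAt_iff_eventually_differentiableAt]
  have hlim : Tendsto g (𝓝 (ζ a)) (𝓝 a) := by
    simpa [ContinuousAt, hga] using hg.continuousAt
  filter_upwards [hright.eventually_nhds, hg.eventually (by simp),
    hlim.eventually (hζ.eventually (by simp)), hlim.eventually (hw.eventually (by simp)),
    hlim.eventually hfac] with u hu hgu hζu hwu ⟨c, hc⟩
  have hg' := (hgu.differentiableAt one_ne_zero).hasFDerivAt
  have hζ' := (hζu.differentiableAt one_ne_zero).hasFDerivAt.comp u hg'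
  have hw' := (hwu.differentiableAt one_ne_zero).hasFDerivAt.comp u hg'
  have hid := hζ'.unique ((hasFDerivAt_id (𝕜 := ℝ) u).congr_of_eventuallyEq hu)
  have hmul : HasFDerivAt (w ∘ g)
      ((c • (ContinuousLinearMap.id ℂ ℂ)).restrictScalars ℝ) u := by
    refine hw'.congr_fderiv ?_
    ext1 v
    have hv := DFunLike.congr_fun hid v
    simp only [ContinuousLinearMap.comp_apply, ContinuousLinearMap.id_apply] at hv
    simp [hc, hv]
  exact (hasFDerivAt_of_restrictScalars ℝ hmul rfl).differentiableAt

/-- A continuous lift of an analytic map through an analytic map with injective derivative is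
analytic. -/
lemma AnalyticAt.of_comp_of_injective_fderiv {D E E' : Type*} [NormedAddCommGroup D]
    [NormedSpace ℝ D] [NormedAddCommGroup E] [NormedSpace ℝ E]
    [FiniteDimensional ℝ E] [NormedAddCommGroup E'] [NormedSpace ℝ E'] [FiniteDimensional ℝ E']
    (hdim : Module.finrank ℝ E = Module.finrank ℝ E') {f : E → E'} {f' : E →L[ℝ] E'} {k : D → E}
    {x : D} (hf : AnalyticAt ℝ f (k x)) (hf' : HasFDerivAt f f' (k x))
    (hinj : ∀ v, f' v = 0 → v = 0) (hk : ContinuousAt k x)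
    (hfk : AnalyticAt ℝ (fun y => f (k y)) x) : AnalyticAt ℝ k x := by
  have : CompleteSpace E' := FiniteDimensional.complete ℝ E'
  obtain ⟨g, hg, -, hleft, -⟩ :=
    (hf.contDiffAt (n := ω)).exists_local_inverse (by simp) hf' hinj hdim
  exact (AnalyticAt.fun_comp (f := fun y => f (k y)) hg.analyticAt hfk).congr (hk.eventually hleft)

/-- The time-dependent pair of real equations that the characteristic coordinate of the complex
Burgers equation satisfies determines that coordinate analytically. -/
lemma analyticAt_of_characteristic_equations {ζ : ℝ × ℝ → ℂ} {h H : ℂ → ℂ} {z₀ : ℝ × ℝ} {C : ℝ}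
    (hζ : ContinuousAt ζ z₀) (hh : AnalyticAt ℂ h (ζ z₀)) (him : (h (ζ z₀)).im ≠ 0)
    (hH : ∀ᶠ u in 𝓝 (ζ z₀), HasDerivAt H (h u) u)
    (h₁ : ∀ᶠ z in 𝓝 z₀, (ζ z + (z.1 - z₀.1 : ℝ) * h (ζ z)).im = 0)
    (h₂ : ∀ᶠ z in 𝓝 z₀, (H (ζ z) + (z.1 - z₀.1 : ℝ) * (h (ζ z) ^ 2 / 2)).im = π * z.2 + C) :
    AnalyticAt ℝ ζ z₀ := by
  have hHan : AnalyticAt ℂ H (ζ z₀) :=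
    Complex.analyticAt_iff_eventually_differentiableAt.2
      (hH.mono fun u hu => hu.differentiableAt)
  set Ψ : ℝ × ℂ → ℝ × ℝ × ℝ := fun x =>
    (x.1, Complex.imCLM (x.2 + Complex.ofRealCLM (x.1 - z₀.1) * h x.2),
      Complex.imCLM (H x.2 + Complex.ofRealCLM (x.1 - z₀.1) * (h x.2 ^ 2 / 2))) with hΨ
  have hha : AnalyticAt ℝ (fun x : ℝ × ℂ => h x.2) (z₀.1, ζ z₀) :=
    AnalyticAt.fun_comp (f := fun x : ℝ × ℂ => x.2) (hh.restrictScalars (𝕜 := ℝ)) analyticAt_snd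
  have hHa : AnalyticAt ℝ (fun x : ℝ × ℂ => H x.2) (z₀.1, ζ z₀) :=
    AnalyticAt.fun_comp (f := fun x : ℝ × ℂ => x.2) (hHan.restrictScalars (𝕜 := ℝ)) analyticAt_snd
  have ht : AnalyticAt ℝ (fun x : ℝ × ℂ => Complex.ofRealCLM (x.1 - z₀.1)) (z₀.1, ζ z₀) :=
    (Complex.ofRealCLM.analyticAt _).fun_comp (analyticAt_fst.sub analyticAt_const)
  have hΨan : AnalyticAt ℝ Ψ (z₀.1, ζ z₀) := by
    refine analyticAt_fst.prod (AnalyticAt.prod ?_ ?_)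
    · exact (Complex.imCLM.analyticAt _).fun_comp (analyticAt_snd.add (ht.mul hha))
    · exact (Complex.imCLM.analyticAt _).fun_comp
        (hHa.add (ht.mul ((hha.pow 2).div analyticAt_const two_ne_zero)))
  have hΨ' := hΨan.differentiableAt.hasFDerivAt
  have hd : ∀ v : ℝ × ℂ, fderiv ℝ Ψ (z₀.1, ζ z₀) v =
      (v.1, (v.2 + v.1 * h (ζ z₀)).im, (h (ζ z₀) * v.2 + v.1 * (h (ζ z₀) ^ 2 / 2)).im) := by
    intro v
    have hfst : HasFDerivAt (fun x : ℝ × ℂ => Complex.ofRealCLM (x.1 - z₀.1))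
        (Complex.ofRealCLM.comp (ContinuousLinearMap.fst ℝ ℝ ℂ)) (z₀.1, ζ z₀) :=
      Complex.ofRealCLM.hasFDerivAt.comp (z₀.1, ζ z₀) (hasFDerivAt_fst.sub_const z₀.1)
    have hsnd : HasFDerivAt (fun x : ℝ × ℂ => x.2) (ContinuousLinearMap.snd ℝ ℝ ℂ)
        (z₀.1, ζ z₀) := hasFDerivAt_snd
    have hHd : HasFDerivAt (fun x : ℝ × ℂ => H x.2)
        (h (ζ z₀) • ContinuousLinearMap.snd ℝ ℝ ℂ) (z₀.1, ζ z₀) :=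
      hH.self_of_nhds.comp_hasFDerivAt (z₀.1, ζ z₀) hsnd
    have hsq := (hha.pow 2).div (analyticAt_const (v := (2 : ℂ))) two_ne_zero
    have e := hasFDerivAt_fst.prodMk
      ((Complex.imCLM.hasFDerivAt.comp (z₀.1, ζ z₀)
          (hsnd.add (hfst.mul hha.differentiableAt.hasFDerivAt))).prodMk
        (Complex.imCLM.hasFDerivAt.comp (z₀.1, ζ z₀)
          (hHd.add (hfst.mul hsq.differentiableAt.hasFDerivAt))))
    rw [hΨ'.unique e]
    simp [mul_comm]
  have hk : AnalyticAt ℝ (fun z => (z.1, ζ z)) z₀ := by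
    refine AnalyticAt.of_comp_of_injective_fderiv (f := Ψ) (x := z₀) ?_ hΨan hΨ' ?_
      (continuousAt_fst.prodMk hζ) ?_
    · simp [Complex.finrank_real_complex]
    · rintro ⟨s, v⟩ hv
      rw [hd] at hv
      simp only [Prod.mk_eq_zero] at hv
      obtain ⟨rfl, hv₁, hv₂⟩ := hv
      simp only [Complex.ofReal_zero, zero_mul, add_zero] at hv₁ hv₂
      rw [Complex.mul_im, hv₁] at hv₂
      have : v.re = 0 := by simpa [him] using hv₂
      exact Prod.ext rfl (Complex.ext this hv₁)
    · have han : AnalyticAt ℝ (fun z : ℝ × ℝ => (z.1, (0 : ℝ), π * z.2 + C)) z₀ :=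
        analyticAt_fst.prod (analyticAt_const.prod
          ((analyticAt_const.mul analyticAt_snd).add analyticAt_const))
      refine han.congr ?_
      filter_upwards [h₁, h₂] with z hz₁ hz₂
      simp only [hΨ, Complex.imCLM_apply, Complex.ofRealCLM_apply, hz₁, hz₂]
  exact AnalyticAt.fun_comp (g := Prod.snd) analyticAt_snd hk

/-- A function with `C¹` partial derivatives `p`, `q` solving
`∂_t p + π² q⁻⁴ ∂_y q = 0`, `∂_y p = ∂_t q` is real analytic: the function `w = p + i π / q` is a
holomorphic function of the complex coordinate `F - (t - t₀) w`. -/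
lemma analyticAt_of_partials {F p q : ℝ × ℝ → ℝ} {z₀ : ℝ × ℝ}
    (hF : ContDiffAt ℝ 1 F z₀) (hp : ContDiffAt ℝ 1 p z₀) (hq : ContDiffAt ℝ 1 q z₀)
    (hF' : ∀ᶠ z in 𝓝 z₀, ∀ v, fderiv ℝ F z v = v.1 * p z + v.2 * q z) (hq₀ : q z₀ ≠ 0)
    (hsymm : ∀ᶠ z in 𝓝 z₀, fderiv ℝ p z (0, 1) = fderiv ℝ q z (1, 0))
    (heq : ∀ᶠ z in 𝓝 z₀,
      fderiv ℝ p z (1, 0) + π ^ 2 * ((q z) ^ 4)⁻¹ * fderiv ℝ q z (0, 1) = 0) :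
    AnalyticAt ℝ F z₀ := by
  set w : ℝ × ℝ → ℂ := fun z =>
    Complex.ofRealCLM (p z) + Complex.ofRealCLM (π * (q z)⁻¹) * Complex.I with hw
  set ζ : ℝ × ℝ → ℂ := fun z =>
    Complex.ofRealCLM (F z) - Complex.ofRealCLM (z.1 - z₀.1) * w z with hζ
  have hwC : ContDiffAt ℝ 1 w z₀ :=
    (Complex.ofRealCLM.contDiff.contDiffAt.comp z₀ hp).add
      ((Complex.ofRealCLM.contDiff.contDiffAt.comp z₀
        (contDiffAt_const.mul (hq.inv hq₀))).mul contDiffAt_const)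
  have hζC : ContDiffAt ℝ 1 ζ z₀ :=
    (Complex.ofRealCLM.contDiff.contDiffAt.comp z₀ hF).sub
      ((Complex.ofRealCLM.contDiff.contDiffAt.comp z₀
        (contDiffAt_fst.sub contDiffAt_const)).mul hwC)
  have hw₀ : (w z₀).im ≠ 0 := by simp [hw, Real.pi_ne_zero, hq₀]
  have hne : ∀ᶠ z in 𝓝 z₀, q z ≠ 0 := hq.continuousAt.eventually_ne hq₀
  have hwd : ∀ᶠ z in 𝓝 z₀, ∀ v, fderiv ℝ w z v =
      (fderiv ℝ p z v : ℂ) - (π * fderiv ℝ q z v / (q z) ^ 2 : ℝ) * Complex.I := by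
    filter_upwards [hp.eventually (by simp), hq.eventually (by simp), hne] with z hpz hqz hz v
    have hinv := ((hasDerivAt_inv hz).comp_hasFDerivAt z
      (hqz.differentiableAt one_ne_zero).hasFDerivAt).const_mul π
    have e := (Complex.ofRealCLM.hasFDerivAt.comp z
        (hpz.differentiableAt one_ne_zero).hasFDerivAt).add
      ((Complex.ofRealCLM.hasFDerivAt.comp z hinv).mul_const Complex.I)
    have e' : HasFDerivAt w _ z := e
    rw [e'.fderiv]
    simp
    ring
  have hζd : ∀ᶠ z in 𝓝 z₀, ∀ v, fderiv ℝ ζ z v =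
      (v.1 * p z + v.2 * q z : ℂ) - (v.1 * w z + (z.1 - z₀.1 : ℝ) * fderiv ℝ w z v) := by
    filter_upwards [hF.eventually (by simp), hwC.eventually (by simp), hF'] with z hFz hwz hz v
    have hfst : HasFDerivAt (fun x : ℝ × ℝ => Complex.ofRealCLM (x.1 - z₀.1))
        (Complex.ofRealCLM.comp (ContinuousLinearMap.fst ℝ ℝ ℝ)) z :=
      Complex.ofRealCLM.hasFDerivAt.comp z (hasFDerivAt_fst.sub_const z₀.1)
    have e := (Complex.ofRealCLM.hasFDerivAt.comp z
        (hFz.differentiableAt one_ne_zero).hasFDerivAt).sub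
      (hfst.mul (hwz.differentiableAt one_ne_zero).hasFDerivAt)
    have e' : HasFDerivAt ζ _ z := e
    rw [e'.fderiv]
    simp [hz]
    ring
  have hinj : ∀ v, fderiv ℝ ζ z₀ v = 0 → v = 0 := by
    intro v hv
    rw [hζd.self_of_nhds v] at hv
    have h1 := congrArg Complex.im hv
    have h2 := congrArg Complex.re hv
    simp [hw, Real.pi_ne_zero, hq₀] at h1
    simp [h1, hq₀] at h2
    exact Prod.ext h1 h2
  have hζne : ∀ᶠ z in 𝓝 z₀, fderiv ℝ ζ z (0, 1) ≠ 0 := by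
    have hc : ContinuousAt (fun z => fderiv ℝ ζ z (0, 1)) z₀ :=
      ((hζC.fderiv_right (m := 0) (by simp)).continuousAt).clm_apply continuousAt_const
    refine hc.eventually_ne fun h => ?_
    simpa using congrArg Prod.snd (hinj _ h)
  have hsplit : ∀ (L : ℝ × ℝ →L[ℝ] ℂ) (v : ℝ × ℝ), L v = v.1 * L (1, 0) + v.2 * L (0, 1) := by
    intro L v
    conv_lhs => rw [show v = v.1 • ((1 : ℝ), (0 : ℝ)) + v.2 • ((0 : ℝ), (1 : ℝ)) by ext <;> simp]
    simp only [map_add, map_smul, Complex.real_smul]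
  have hfac : ∀ᶠ z in 𝓝 z₀, ∃ c : ℂ, ∀ v, fderiv ℝ w z v = c * fderiv ℝ ζ z v := by
    filter_upwards [hwd, hζd, hζne, hne, hsymm, heq] with z hwz hζz hζnz hqz hs he
    have hqc : (q z : ℂ) ≠ 0 := by exact_mod_cast hqz
    have he' : (fderiv ℝ p z (1, 0) : ℂ) = - (π ^ 2 * ((q z) ^ 4)⁻¹ * fderiv ℝ q z (0, 1)) := by
      exact_mod_cast eq_neg_of_add_eq_zero_left he
    have hwt : fderiv ℝ w z (1, 0) = -(Complex.I * π / (q z) ^ 2) * fderiv ℝ w z (0, 1) := by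
      rw [hwz, hwz, he', hs]
      push_cast
      field_simp
      linear_combination (-(π : ℂ) * fderiv ℝ q z (0, 1)) * Complex.I_sq
    have hζt : fderiv ℝ ζ z (1, 0) = -(Complex.I * π / (q z) ^ 2) * fderiv ℝ ζ z (0, 1) := by
      rw [hζz, hζz, hwt]
      simp only [hw, Complex.ofRealCLM_apply]
      push_cast
      field_simp
      ring
    refine ⟨fderiv ℝ w z (0, 1) / fderiv ℝ ζ z (0, 1), fun v => ?_⟩
    rw [hsplit (fderiv ℝ w z) v, hsplit (fderiv ℝ ζ z) v, hwt, hζt]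
    field_simp
  obtain ⟨h, hh, hwh⟩ := exists_holomorphic_factor (by simp) hζC hinj hwC hfac
  obtain ⟨r, hr, hball⟩ := Metric.eventually_nhds_iff_ball.1
    (Complex.analyticAt_iff_eventually_differentiableAt.1 hh)
  obtain ⟨H, hHr⟩ := DifferentiableOn.isExactOn_ball
    (fun u hu => (hball u hu).differentiableWithinAt)
  have hH : ∀ᶠ u in 𝓝 (ζ z₀), HasDerivAt H (h u) u :=
    Filter.eventually_of_mem (Metric.ball_mem_nhds _ hr) hHr
  have hconst : ∃ C : ℝ, ∀ᶠ z in 𝓝 z₀,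
      (H (ζ z) + (z.1 - z₀.1 : ℝ) * (w z ^ 2 / 2)).im = π * z.2 + C := by
    set K : ℝ × ℝ → ℝ := fun z => Complex.imCLM
      (H (ζ z) + Complex.ofRealCLM (z.1 - z₀.1) * (w z ^ 2 / 2)) - π * z.2 with hK
    have hK' : ∀ᶠ z in 𝓝 z₀, HasFDerivAt K (0 : ℝ × ℝ →L[ℝ] ℝ) z := by
      filter_upwards [hζC.eventually (by simp), hwC.eventually (by simp), hζd, hne, hwh,
        hζC.continuousAt.eventually hH] with z hζz hwz hζdz hqz hwhz hHz
      have hfst : HasFDerivAt (fun x : ℝ × ℝ => Complex.ofRealCLM (x.1 - z₀.1))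
          (Complex.ofRealCLM.comp (ContinuousLinearMap.fst ℝ ℝ ℝ)) z :=
        Complex.ofRealCLM.hasFDerivAt.comp z (hasFDerivAt_fst.sub_const z₀.1)
      have hsq : HasDerivAt (fun u : ℂ => u ^ 2 / 2) (w z) (w z) := by
        simpa using (hasDerivAt_pow 2 (w z)).div_const 2
      have e := (Complex.imCLM.hasFDerivAt.comp z
        ((hHz.comp_hasFDerivAt z (hζz.differentiableAt one_ne_zero).hasFDerivAt).add
          (hfst.mul (hsq.comp_hasFDerivAt z
            (hwz.differentiableAt one_ne_zero).hasFDerivAt)))).sub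
        ((hasFDerivAt_snd (𝕜 := ℝ) (p := z)).const_mul π)
      have e' : HasFDerivAt K _ z := e
      refine e'.congr_fderiv (ContinuousLinearMap.ext fun v => ?_)
      have key : w z * fderiv ℝ ζ z v + ((z.1 - z₀.1 : ℝ) * (w z * fderiv ℝ w z v) +
          w z ^ 2 / 2 * v.1) = w z * (v.1 * p z + v.2 * q z) - v.1 * (w z ^ 2 / 2) := by
        rw [hζdz]
        ring
      have him : (w z * (v.1 * p z + v.2 * q z) - v.1 * (w z ^ 2 / 2)).im = π * v.2 := by
        simp [hw, pow_two]
        field_simp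
        ring
      rw [← key] at him
      rw [← hwhz]
      exact sub_eq_zero.2 him
    obtain ⟨ρ, hρ, hballK⟩ := Metric.eventually_nhds_iff_ball.1 hK'
    obtain ⟨C, hC⟩ := Metric.isOpen_ball.exists_is_const_of_fderiv_eq_zero (𝕜 := ℝ)
      (convex_ball z₀ ρ).isPreconnected
      (fun z hz => (hballK z hz).differentiableAt.differentiableWithinAt)
      (fun z hz => (hballK z hz).fderiv)
    refine ⟨C, Filter.eventually_of_mem (Metric.ball_mem_nhds _ hρ) fun z hz => ?_⟩
    rw [← hC z hz]
    simp [hK]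
  obtain ⟨C, hC⟩ := hconst
  have hζan : AnalyticAt ℝ ζ z₀ := by
    refine analyticAt_of_characteristic_equations hζC.continuousAt hh ?_ hH (C := C) ?_ ?_
    · rwa [← hwh.self_of_nhds]
    · filter_upwards [hwh] with z hz
      rw [← hz]
      simp [hζ]
    · filter_upwards [hwh, hC] with z hz hCz
      rw [← hz, hCz]
  have hhζ : AnalyticAt ℝ (fun z => h (ζ z)) z₀ := (hh.restrictScalars (𝕜 := ℝ)).fun_comp hζan
  have hfin : AnalyticAt ℝ
      (fun z => Complex.reCLM (ζ z + Complex.ofRealCLM (z.1 - z₀.1) * h (ζ z))) z₀ :=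
    (Complex.reCLM.analyticAt _).fun_comp (hζan.add
      (((Complex.ofRealCLM.analyticAt _).fun_comp (analyticAt_fst.sub analyticAt_const)).mul hhζ))
  refine hfin.congr ?_
  filter_upwards [hwh] with z hz
  rw [← hz]
  simp [hζ]

lemma pdT_eq_fderiv {F : ℝ × ℝ → ℝ} {z : ℝ × ℝ} (hF : DifferentiableAt ℝ F z) :
    pdT F z = fderiv ℝ F z (1, 0) :=
  (hF.hasFDerivAt.comp_hasDerivAt z.1
    ((hasDerivAt_id z.1).prodMk (hasDerivAt_const z.1 z.2))).deriv

lemma pdX_eq_fderiv {F : ℝ × ℝ → ℝ} {z : ℝ × ℝ} (hF : DifferentiableAt ℝ F z) :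
    pdX F z = fderiv ℝ F z (0, 1) :=
  (hF.hasFDerivAt.comp_hasDerivAt z.2
    ((hasDerivAt_const z.2 z.1).prodMk (hasDerivAt_id z.2))).deriv

theorem statement7 (ε : ℝ) (hε : ε ∈ Ioo (0 : ℝ) 1) (R : Set (ℝ × ℝ)) (hR : IsOpen R)
    (F : ℝ × ℝ → ℝ) (hF : ContDiffOn ℝ 2 F R)
    (hadm : ∀ z ∈ R, -ε⁻¹ < pdX F z ∧ pdX F z < -ε)
    (hE : SatisfiesE F R) :
    ∀ z ∈ R, AnalyticAt ℝ F z := by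
  intro z₀ hz₀
  have hC : ∀ z ∈ R, ContDiffAt ℝ 2 F z := fun z hz => hF.contDiffAt (hR.mem_nhds hz)
  have hdiff : ∀ z ∈ R, DifferentiableAt ℝ F z := fun z hz =>
    (hC z hz).differentiableAt two_ne_zero
  have hfd : ∀ z ∈ R, ContDiffAt ℝ 1 (fderiv ℝ F) z := fun z hz =>
    (hC z hz).fderiv_right (by norm_num)
  have hT : ∀ z ∈ R, pdT F =ᶠ[𝓝 z] fun x => fderiv ℝ F x (1, 0) := fun z hz =>
    (hR.eventually_mem hz).mono fun x hx => pdT_eq_fderiv (hdiff x hx)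
  have hX : ∀ z ∈ R, pdX F =ᶠ[𝓝 z] fun x => fderiv ℝ F x (0, 1) := fun z hz =>
    (hR.eventually_mem hz).mono fun x hx => pdX_eq_fderiv (hdiff x hx)
  have hTC : ∀ z ∈ R, ContDiffAt ℝ 1 (pdT F) z := fun z hz =>
    ((hfd z hz).clm_apply contDiffAt_const).congr_of_eventuallyEq (hT z hz)
  have hXC : ∀ z ∈ R, ContDiffAt ℝ 1 (pdX F) z := fun z hz =>
    ((hfd z hz).clm_apply contDiffAt_const).congr_of_eventuallyEq (hX z hz)
  have hmem := hR.eventually_mem hz₀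
  refine analyticAt_of_partials ((hC z₀ hz₀).of_le one_le_two) (hTC z₀ hz₀) (hXC z₀ hz₀)
    (hmem.mono fun z hz v => ?_) (hE z₀ hz₀).1 (hmem.mono fun z hz => ?_)
    (hmem.mono fun z hz => ?_)
  · rw [pdT_eq_fderiv (hdiff z hz), pdX_eq_fderiv (hdiff z hz)]
    conv_lhs => rw [show v = v.1 • ((1 : ℝ), (0 : ℝ)) + v.2 • ((0 : ℝ), (1 : ℝ)) by ext <;> simp]
    simp only [map_add, map_smul, smul_eq_mul]
  · have hd := ((hfd z hz).differentiableAt one_ne_zero).hasFDerivAt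
    rw [(hT z hz).fderiv_eq, (hX z hz).fderiv_eq,
      (hd.clm_apply (hasFDerivAt_const ((1 : ℝ), (0 : ℝ)) z)).fderiv,
      (hd.clm_apply (hasFDerivAt_const ((0 : ℝ), (1 : ℝ)) z)).fderiv]
    simpa using (hC z hz).isSymmSndFDerivAt (by simp) (0, 1) (1, 0)
  · rw [← pdT_eq_fderiv ((hTC z hz).differentiableAt one_ne_zero),
      ← pdX_eq_fderiv ((hXC z hz).differentiableAt one_ne_zero)]
    exact (hE z hz).2
end
end

section
/- Let n, S ≥ 1 be integers, r, B ≥ 1 reals, u, v ∈ 𝕎_n ∩ ℤⁿ, and f, g : ⟦0,S⟧ → ℤ with f(s) ≤ g(s) for all s. Suppose the (finite) set of non-intersecting discrete path ensembles p = (p₁,…,pₙ) on ⟦0,S⟧ that start at u, end at v, and remain above f and below g is nonempty, and let p be uniformly distributed on this set. Fix (t,w) ∈ ⟦0,S⟧×ℤ and let ℰ denote the event {H^p(t,w) ≤ B}. Then there exists a deterministic real number 𝔜 ∈ [0,n], depending only on (u, v, f, g, S, t, w, B), such that ℙ[|H^p(t,w) − 𝔜| ≥ r·B^{1/2}] ≤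 2·exp(−r²/4) + 2·ℙ[ℰᶜ]. -/
open Real Set

noncomputable section

/-- `p` is a non-intersecting ensemble of `n` discrete paths on `⟦0, S⟧` that starts at `u`,
ends at `v`, remains strictly above `f` and strictly below `g`. -/
def IsPathEnsemble (n S : ℕ) (u v : Fin n → ℤ) (f g : ℕ → ℤ)
    (p : Fin n → Fin (S + 1) → ℤ) : Prop :=
  (∀ (j : Fin n) (t : ℕ) (ht : t < S),
      p j ⟨t + 1, by omega⟩ - p j ⟨t, by omega⟩ = 0 ∨
        p j ⟨t + 1, by omega⟩ - p j ⟨t, by omega⟩ = 1) ∧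
  (∀ (t : Fin (S + 1)) (j k : Fin n), j < k → p k t < p j t) ∧
  (∀ j : Fin n, p j ⟨0, by omega⟩ = u j) ∧
  (∀ j : Fin n, p j ⟨S, by omega⟩ = v j) ∧
  (∀ (j : Fin n) (t : Fin (S + 1)), f t.val < p j t ∧ p j t < g t.val)

/-- The height function `H^p(t, w) = #{j : p_j(t) > w}` of a discrete path ensemble. -/
def heightFn (n S : ℕ) (p : Fin n → Fin (S + 1) → ℤ) (t : Fin (S + 1)) (w : ℤ) : ℕ :=
  (Finset.univ.filter fun j : Fin n => w < p j t).card

lemma IsPathEnsemble.finite (n S : ℕ) (u v : Fin n → ℤ) (f g : ℕ → ℤ) :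
    {p : Fin n → Fin (S + 1) → ℤ | IsPathEnsemble n S u v f g p}.Finite :=
  (Set.finite_Icc (fun _ s => f s.val) (fun _ s => g s.val)).subset fun _ hp =>
    ⟨fun j s => (hp.2.2.2.2 j s).1.le, fun j s => (hp.2.2.2.2 j s).2.le⟩

lemma heightFn_le (n S : ℕ) (p : Fin n → Fin (S + 1) → ℤ) (t : Fin (S + 1)) (w : ℤ) :
    heightFn n S p t w ≤ n := by
  simpa [heightFn] using Finset.card_le_univ (Finset.univ.filter fun j : Fin n => w < p j t)

lemma heightFn_eq_of_forall {n S : ℕ} {p : Fin n → Fin (S + 1) → ℤ} {t : Fin (S + 1)} {w : ℤ}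
    {k : ℕ} (hk : k ≤ n) (h : ∀ j : Fin n, w < p j t ↔ j.val < k) : heightFn n S p t w = k := by
  simp [heightFn, h, Fin.card_filter_val_lt, hk]

section Ensemble

variable {n S : ℕ} {u v : Fin n → ℤ} {f g : ℕ → ℤ} {p q : Fin n → Fin (S + 1) → ℤ}
  {t : Fin (S + 1)}

lemma IsPathEnsemble.le_of_val_le (hp : IsPathEnsemble n S u v f g p) (s : Fin (S + 1))
    {i j : Fin n} (h : i.val ≤ j.val) : p j s ≤ p i s := by
  rcases (Fin.le_def.2 h).eq_or_lt with rfl | h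
  · exact le_rfl
  · exact (hp.2.1 s i j h).le

lemma IsPathEnsemble.lt_iff (hp : IsPathEnsemble n S u v f g p) (w : ℤ) (j : Fin n) :
    w < p j t ↔ j.val < heightFn n S p t w := by
  constructor
  · intro hj
    have hsub : Finset.Iic j ⊆ Finset.univ.filter fun j : Fin n => w < p j t := fun i hi => by
      have := hp.le_of_val_le t (Fin.le_def.1 (Finset.mem_Iic.1 hi))
      simp only [Finset.mem_filter, Finset.mem_univ, true_and]
      omega
    have := Finset.card_le_card hsub
    rw [Fin.card_Iic] at this
    exact this
  · intro hj
    by_contra hw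
    have hsub : (Finset.univ.filter fun j : Fin n => w < p j t) ⊆ Finset.Iio j := fun i hi => by
      simp only [Finset.mem_filter, Finset.mem_univ, true_and] at hi
      rw [Finset.mem_Iio]
      by_contra hij
      have := hp.le_of_val_le t (Fin.le_def.1 (not_lt.1 hij))
      omega
    have := Finset.card_le_card hsub
    rw [Fin.card_Iio] at this
    unfold heightFn at hj
    omega

lemma IsPathEnsemble.heightFn_succ (hp : IsPathEnsemble n S u v f g p) (w : ℤ) :
    heightFn n S p t w = heightFn n S p t (w + 1) ∨
      heightFn n S p t w = heightFn n S p t (w + 1) + 1 := by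
  have hle : heightFn n S p t (w + 1) ≤ heightFn n S p t w :=
    Finset.card_le_card fun j hj => by
      simp only [Finset.mem_filter, Finset.mem_univ, true_and] at hj ⊢
      omega
  have hn := heightFn_le n S p t w
  by_contra hcon
  have h1 := (hp.lt_iff (t := t) (w + 1) ⟨heightFn n S p t (w + 1), by omega⟩).not
  have h2 := hp.lt_iff (t := t) w ⟨heightFn n S p t (w + 1) + 1, by omega⟩
  have h3 := hp.2.1 t ⟨heightFn n S p t (w + 1), by omega⟩
    ⟨heightFn n S p t (w + 1) + 1, by omega⟩ (by simp [Fin.lt_def])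
  simp only [lt_irrefl, not_false_eq_true, iff_true] at h1
  have := h2.2 (by simp only; omega)
  omega

/-- The upper part of the index-shifted exchange of two ensembles: `p j` is raised to
`q (j + m)`. -/
def shiftMax (m : ℕ) (q p : Fin n → Fin (S + 1) → ℤ) : Fin n → Fin (S + 1) → ℤ := fun j s =>
  if h : j.val + m < n then max (p j s) (q ⟨j.val + m, h⟩ s) else p j s

/-- The lower part of the index-shifted exchange of two ensembles: `q j` is lowered to
`p (j - m)`. -/
def shiftMin (m : ℕ) (q p : Fin n → Fin (S + 1) → ℤ) : Fin n → Fin (S + 1) → ℤ := fun j s =>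
  if m ≤ j.val then min (q j s) (p ⟨j.val - m, by omega⟩ s) else q j s

lemma IsPathEnsemble.shiftMax (hq : IsPathEnsemble n S u v f g q)
    (hp : IsPathEnsemble n S u v f g p) (m : ℕ) :
    IsPathEnsemble n S u v f g (shiftMax m q p) := by
  refine ⟨fun j s hs => ?_, fun s j k hjk => ?_, fun j => ?_, fun j => ?_, fun j s => ?_⟩
  · have h1 := hp.1 j s hs
    unfold _root_.shiftMax
    split_ifs with h
    · have h2 := hq.1 ⟨_, h⟩ s hs
      omega
    · exact h1
  · have h1 := hp.2.1 s j k hjk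
    have hjk' := Fin.lt_def.1 hjk
    unfold _root_.shiftMax
    split_ifs with h h' h'
    · have h2 := hq.2.1 s ⟨_, h'⟩ ⟨_, h⟩ (by simp only [Fin.lt_def]; omega)
      omega
    · omega
    · omega
    · exact h1
  · have h1 := hp.2.2.1 j
    unfold _root_.shiftMax
    split_ifs with h
    · have h2 := hq.2.2.1 ⟨_, h⟩
      have h3 := hq.2.2.1 j
      have h4 := hq.le_of_val_le ⟨0, by omega⟩ (i := j) (j := ⟨_, h⟩) (by simp)
      omega
    · exact h1
  · have h1 := hp.2.2.2.1 j
    unfold _root_.shiftMax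
    split_ifs with h
    · have h2 := hq.2.2.2.1 ⟨_, h⟩
      have h3 := hq.2.2.2.1 j
      have h4 := hq.le_of_val_le ⟨S, by omega⟩ (i := j) (j := ⟨_, h⟩) (by simp)
      omega
    · exact h1
  · have h1 := hp.2.2.2.2 j s
    unfold _root_.shiftMax
    split_ifs with h
    · have h2 := hq.2.2.2.2 ⟨_, h⟩ s
      omega
    · exact h1

lemma IsPathEnsemble.shiftMin (hq : IsPathEnsemble n S u v f g q)
    (hp : IsPathEnsemble n S u v f g p) (m : ℕ) :
    IsPathEnsemble n S u v f g (shiftMin m q p) := by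
  refine ⟨fun j s hs => ?_, fun s j k hjk => ?_, fun j => ?_, fun j => ?_, fun j s => ?_⟩
  · have h1 := hq.1 j s hs
    unfold _root_.shiftMin
    split_ifs with h
    · have h2 := hp.1 ⟨j.val - m, by omega⟩ s hs
      omega
    · exact h1
  · have h1 := hq.2.1 s j k hjk
    have hjk' := Fin.lt_def.1 hjk
    unfold _root_.shiftMin
    split_ifs with h h' h'
    · have h2 := hp.2.1 s ⟨j.val - m, by omega⟩ ⟨k.val - m, by omega⟩
        (by simp only [Fin.lt_def]; omega)
      omega
    · omega
    · omega
    · exact h1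
  · have h1 := hq.2.2.1 j
    unfold _root_.shiftMin
    split_ifs with h
    · have h2 := hp.2.2.1 j
      have h4 := hp.le_of_val_le ⟨0, by omega⟩ (i := ⟨j.val - m, by omega⟩) (j := j) (by simp)
      omega
    · exact h1
  · have h1 := hq.2.2.2.1 j
    unfold _root_.shiftMin
    split_ifs with h
    · have h2 := hp.2.2.2.1 j
      have h4 := hp.le_of_val_le ⟨S, by omega⟩ (i := ⟨j.val - m, by omega⟩) (j := j) (by simp)
      omega
    · exact h1
  · have h1 := hq.2.2.2.2 j s
    unfold _root_.shiftMin
    split_ifs with h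
    · have h2 := hp.2.2.2.2 ⟨j.val - m, by omega⟩ s
      omega
    · exact h1

lemma IsPathEnsemble.heightFn_shiftMin (hq : IsPathEnsemble n S u v f g q)
    (hp : IsPathEnsemble n S u v f g p) {m k : ℕ} {w : ℤ}
    (hkp : heightFn n S p t w = k) (hkq : heightFn n S q t w = k + m) :
    heightFn n S (_root_.shiftMin m q p) t w = k + m := by
  refine heightFn_eq_of_forall (hkq ▸ heightFn_le n S q t w) fun j => ?_
  have h1 := hq.lt_iff (t := t) w j
  unfold _root_.shiftMin
  split_ifs with h
  · have h2 := hp.lt_iff (t := t) w ⟨j.val - m, by omega⟩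
    simp only [hkp] at h2
    rw [lt_min_iff, h1, h2, hkq]
    omega
  · rw [h1, hkq]

lemma IsPathEnsemble.heightFn_shiftMax (hq : IsPathEnsemble n S u v f g q)
    (hp : IsPathEnsemble n S u v f g p) {m k : ℕ} {w : ℤ}
    (hkp : heightFn n S p t w ≤ k) (hkq : heightFn n S q t w = k + m) :
    heightFn n S (_root_.shiftMax m q p) t w = k := by
  have hn := hkq ▸ heightFn_le n S q t w
  refine heightFn_eq_of_forall (by omega) fun j => ?_
  have h1 := hp.lt_iff (t := t) w j
  unfold _root_.shiftMax
  split_ifs with h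
  · have h2 := hq.lt_iff (t := t) w ⟨j.val + m, h⟩
    simp only [hkq] at h2
    rw [lt_max_iff, h1, h2]
    omega
  · rw [h1]
    omega

/-- Extension of an ensemble to all integer indices, by the upper barrier `g` for negative
indices and by the lower barrier `f` for indices at least `n`. -/
def extendByBarriers (f g : ℕ → ℤ) (p : Fin n → Fin (S + 1) → ℤ) : ℤ → Fin (S + 1) → ℤ :=
  fun i s => if i < 0 then g s.val else if h : i.toNat < n then p ⟨i.toNat, h⟩ s else f s.val

lemma extendByBarriers_val (p : Fin n → Fin (S + 1) → ℤ) (j : Fin n) :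
    extendByBarriers f g p (j.val : ℤ) = p j := by
  funext s
  simp [extendByBarriers]

lemma extendByBarriers_injective :
    Function.Injective (extendByBarriers f g : (Fin n → Fin (S + 1) → ℤ) → _) := fun p q h => by
  funext j
  rw [← extendByBarriers_val (f := f) (g := g) p j, h, extendByBarriers_val]

lemma IsPathEnsemble.extendByBarriers_inf (hq : IsPathEnsemble n S u v f g q)
    (hp : IsPathEnsemble n S u v f g p) (hfg : ∀ s ≤ S, f s ≤ g s) (m : ℕ) :
    (extendByBarriers f g q ⊓ fun i => extendByBarriers f g p (i - m)) =
      extendByBarriers f g (_root_.shiftMin m q p) := by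
  funext i s
  have hs := hfg s (by omega)
  simp only [Pi.inf_apply, extendByBarriers, _root_.shiftMin]
  by_cases h0 : i < 0
  · have : i - m < 0 := by omega
    simp [h0, this]
  by_cases h1 : i.toNat < n
  · have hb := hq.2.2.2.2 ⟨_, h1⟩ s
    by_cases h2 : m ≤ i.toNat
    · have h3 : ¬ i - m < 0 := by omega
      have h4 : i.toNat - m < n := by omega
      have h5 : (i - m).toNat = i.toNat - m := by omega
      simp [h0, h1, h2, h3, h4, h5]
    · have h3 : i - m < 0 := by omega
      simp only [h0, h1, h2, h3, if_true, if_false, dif_pos]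
      omega
  · simp only [h0, h1, if_false, dif_neg, not_false_eq_true]
    split_ifs with h3 h4
    · omega
    · have hb := hp.2.2.2.2 ⟨_, h4⟩ s
      omega
    · omega

lemma IsPathEnsemble.extendByBarriers_sup (hq : IsPathEnsemble n S u v f g q)
    (hp : IsPathEnsemble n S u v f g p) (hfg : ∀ s ≤ S, f s ≤ g s) (m : ℕ) :
    (extendByBarriers f g q ⊔ fun i => extendByBarriers f g p (i - m)) =
      fun i => extendByBarriers f g (_root_.shiftMax m q p) (i - m) := by
  funext i s
  have hs := hfg s (by omega)
  simp only [Pi.sup_apply, extendByBarriers, _root_.shiftMax]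
  by_cases h0 : i - m < 0
  · simp only [h0, if_true]
    split_ifs with h3 h4
    · omega
    · have hb := hq.2.2.2.2 ⟨_, h4⟩ s
      omega
    · omega
  have h0' : ¬ i < 0 := by omega
  by_cases h1 : (i - m).toNat < n
  · have hb := hp.2.2.2.2 ⟨_, h1⟩ s
    by_cases h2 : i.toNat < n
    · have h5 : (i - m).toNat + m = i.toNat := by omega
      simp only [h0, h0', h1, h2, h5, if_false, dif_pos]
      exact max_comm _ _
    · have h4 : ¬ (i - m).toNat + m < n := by omega
      simp only [h0, h0', h1, h2, h4, if_false, dif_pos, dif_neg, not_false_eq_true]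
      omega
  · have h2 : ¬ i.toNat < n := by omega
    simp only [h0, h0', h1, h2, if_false, dif_neg, not_false_eq_true, max_self]

/-- The conditional probability that site `w + 1` is occupied, given the number of paths
strictly above it, is nonincreasing in that number. -/
lemma card_heightFn_mul_le (Ω : Finset (Fin n → Fin (S + 1) → ℤ))
    (hΩ : ∀ p, p ∈ Ω ↔ IsPathEnsemble n S u v f g p) (hfg : ∀ s ≤ S, f s ≤ g s)
    (t : Fin (S + 1)) (w : ℤ) {k l : ℕ} (hkl : k < l) :
    (Ω.filter fun p => heightFn n S p t (w + 1) = l ∧ heightFn n S p t w = l + 1).card *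
        (Ω.filter fun p => heightFn n S p t (w + 1) = k).card ≤
      (Ω.filter fun p => heightFn n S p t (w + 1) = k ∧ heightFn n S p t w = k + 1).card *
        (Ω.filter fun p => heightFn n S p t (w + 1) = l).card := by
  classical
  obtain ⟨m, rfl⟩ := Nat.exists_eq_add_of_lt hkl
  set m' := m + 1
  have hinj : Function.Injective fun (p : Fin n → Fin (S + 1) → ℤ) (i : ℤ) =>
      extendByBarriers f g p (i - m') := fun p q h => by
    refine extendByBarriers_injective (f := f) (g := g) (funext fun i => ?_)
    simpa using congrFun h (i + m')
  have key := Finset.le_card_infs_mul_card_sups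
    ((Ω.filter fun p => heightFn n S p t (w + 1) = k + m + 1 ∧
      heightFn n S p t w = k + m + 1 + 1).image (extendByBarriers f g))
    ((Ω.filter fun p => heightFn n S p t (w + 1) = k).image
      fun p i => extendByBarriers f g p (i - m'))
  rw [Finset.card_image_of_injective _ extendByBarriers_injective,
    Finset.card_image_of_injective _ hinj] at key
  refine key.trans ?_
  rw [mul_comm]
  refine Nat.mul_le_mul ?_ ?_
  · rw [← Finset.card_image_of_injective _ hinj]
    refine Finset.card_le_card fun x hx => ?_
    simp only [Finset.mem_sups, Finset.mem_image, Finset.mem_filter, hΩ] at hx ⊢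
    obtain ⟨_, ⟨q, ⟨hq, hq1, hq2⟩, rfl⟩, _, ⟨p, ⟨hp, hp1⟩, rfl⟩, rfl⟩ := hx
    refine ⟨shiftMax m' q p, ⟨hq.shiftMax hp m', hq.heightFn_shiftMax hp hp1.le hq1,
      hq.heightFn_shiftMax hp ?_ (by omega)⟩, (hq.extendByBarriers_sup hp hfg m').symm⟩
    have := hp.heightFn_succ (t := t) w
    omega
  · rw [← Finset.card_image_of_injective _ (extendByBarriers_injective (f := f) (g := g))]
    refine Finset.card_le_card fun x hx => ?_
    simp only [Finset.mem_infs, Finset.mem_image, Finset.mem_filter, hΩ] at hx ⊢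
    obtain ⟨_, ⟨q, ⟨hq, hq1, hq2⟩, rfl⟩, _, ⟨p, ⟨hp, hp1⟩, rfl⟩, rfl⟩ := hx
    exact ⟨shiftMin m' q p, ⟨hq.shiftMin hp m', hq.heightFn_shiftMin hp hp1 hq1⟩,
      (hq.extendByBarriers_inf hp hfg m').symm⟩

end Ensemble

/-- A weighted Chebyshev sum inequality for the sequence `z ^ k`. -/
lemma sub_one_mul_sum_pow_mul_le (M : ℕ) (a b : ℕ → ℝ)
    (h : ∀ k l, k < l → b l * a k ≤ b k * a l) {z : ℝ} (hz : 0 ≤ z) :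
    (z - 1) * ((∑ k ∈ Finset.range M, z ^ k * b k) * ∑ k ∈ Finset.range M, a k) ≤
      (z - 1) * ((∑ k ∈ Finset.range M, z ^ k * a k) * ∑ k ∈ Finset.range M, b k) := by
  have hpow : ∀ k l, k < l → (z - 1) * (z ^ k - z ^ l) ≤ 0 := fun k l hkl => by
    rcases le_total 1 z with h1 | h1
    · exact mul_nonpos_of_nonneg_of_nonpos (by linarith)
        (sub_nonpos.2 (pow_le_pow_right₀ h1 hkl.le))
    · exact mul_nonpos_of_nonpos_of_nonneg (by linarith)
        (sub_nonneg.2 (pow_le_pow_of_le_one hz h1 hkl.le))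
  have hterm : ∀ k l, (z - 1) * (z ^ k - z ^ l) * (b k * a l - a k * b l) ≤ 0 := fun k l => by
    rcases lt_trichotomy k l with hkl | rfl | hkl
    · exact mul_nonpos_of_nonpos_of_nonneg (hpow k l hkl) (by linarith [h k l hkl])
    · simp
    · nlinarith [hpow l k hkl, h l k hkl]
  have hsum : ∑ k ∈ Finset.range M, ∑ l ∈ Finset.range M,
      (z - 1) * (z ^ k - z ^ l) * (b k * a l - a k * b l) ≤ 0 :=
    Finset.sum_nonpos fun k _ => Finset.sum_nonpos fun l _ => hterm k l
  have hsplit : ∑ k ∈ Finset.range M, ∑ l ∈ Finset.range M,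
      (z - 1) * (z ^ k - z ^ l) * (b k * a l - a k * b l) =
      2 * ((z - 1) * ((∑ k ∈ Finset.range M, z ^ k * b k) * ∑ k ∈ Finset.range M, a k) -
      (z - 1) * ((∑ k ∈ Finset.range M, z ^ k * a k) * ∑ k ∈ Finset.range M, b k)) := by
    have e : ∀ k l, (z - 1) * (z ^ k - z ^ l) * (b k * a l - a k * b l) =
        (z - 1) * ((z ^ k * b k) * a l) - (z - 1) * ((z ^ k * a k) * b l) +
        ((z - 1) * (a k * (z ^ l * b l)) - (z - 1) * (b k * (z ^ l * a l))) := fun k l => by ring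
    simp only [e, Finset.sum_add_distrib, Finset.sum_sub_distrib, ← Finset.mul_sum,
      ← Finset.sum_mul]
    ring
  linarith

lemma sum_eq_sum_range_card_mul {α : Type*} (s : Finset α) (N : α → ℕ) (M : ℕ)
    (hN : ∀ p ∈ s, N p < M) (F : ℕ → ℝ) :
    ∑ p ∈ s, F (N p) =
      ∑ k ∈ Finset.range M, F k * ((s.filter fun p => N p = k).card : ℝ) := by
  rw [← Finset.sum_fiberwise_of_maps_to (t := Finset.range M) (g := N)
    fun p hp => Finset.mem_range.2 (hN p hp)]
  refine Finset.sum_congr rfl fun k _ => ?_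
  rw [Finset.sum_congr rfl fun p hp => by rw [(Finset.mem_filter.1 hp).2], Finset.sum_const,
    nsmul_eq_mul, mul_comm]

section Concentration

variable {n S : ℕ} {u v : Fin n → ℤ} {f g : ℕ → ℤ}

/-- The height function is sub-Poissonian: its generating function is bounded by that of a
Poisson variable with the same mean. -/
lemma sum_pow_heightFn_le (Ω : Finset (Fin n → Fin (S + 1) → ℤ))
    (hΩ : ∀ p, p ∈ Ω ↔ IsPathEnsemble n S u v f g p) (hne : Ω.Nonempty)
    (hfg : ∀ s ≤ S, f s ≤ g s) (t : Fin (S + 1)) (w : ℤ) {z : ℝ} (hz : 0 ≤ z) :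
    (∑ p ∈ Ω, z ^ heightFn n S p t w) ≤
      Ω.card * exp ((z - 1) * ((∑ p ∈ Ω, (heightFn n S p t w : ℝ)) / Ω.card)) := by
  have hZ : (0 : ℝ) < Ω.card := by exact_mod_cast hne.card_pos
  refine Int.leInductionDown
    (motive := fun w _ => (∑ p ∈ Ω, z ^ heightFn n S p t w) ≤
      Ω.card * exp ((z - 1) * ((∑ p ∈ Ω, (heightFn n S p t w : ℝ)) / Ω.card)))
    (m := max w (g t)) ?_ ?_ w (le_max_left _ _)
  · have h0 : ∀ p ∈ Ω, heightFn n S p t (max w (g t)) = 0 := fun p hp => by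
      refine heightFn_eq_of_forall (Nat.zero_le _) fun j => ?_
      have := (((hΩ p).1 hp).2.2.2.2 j t).2
      simp only [not_lt_zero, iff_false, not_lt]
      exact this.le.trans (le_max_right _ _)
    have h1 : ∑ p ∈ Ω, z ^ heightFn n S p t (max w (g t)) = Ω.card := by
      rw [Finset.sum_congr rfl fun p hp => by rw [h0 p hp, pow_zero]]
      simp
    have h2 : ∑ p ∈ Ω, (heightFn n S p t (max w (g t)) : ℝ) = 0 :=
      Finset.sum_eq_zero fun p hp => by rw [h0 p hp, Nat.cast_zero]
    rw [h1, h2]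
    simp
  · intro x _ ih
    obtain ⟨w, rfl⟩ : ∃ w, x = w + 1 := ⟨x - 1, by ring⟩
    rw [add_sub_cancel_right]
    set N : (Fin n → Fin (S + 1) → ℤ) → ℕ := fun p => heightFn n S p t (w + 1) with hN
    set Ω' := Ω.filter fun p => heightFn n S p t w = N p + 1 with hΩ'
    have hstep : ∀ F : ℕ → ℝ, ∑ p ∈ Ω, F (heightFn n S p t w) =
        ∑ p ∈ Ω, F (N p) + ∑ p ∈ Ω', (F (N p + 1) - F (N p)) := fun F => by
      rw [hΩ', Finset.sum_filter, ← Finset.sum_add_distrib]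
      refine Finset.sum_congr rfl fun p hp => ?_
      rcases ((hΩ p).1 hp).heightFn_succ (t := t) w with h | h
      · rw [if_neg (by simp only [hN]; omega), add_zero, h]
      · rw [if_pos h, h]; ring
    have hNM : ∀ p, N p < n + 1 := fun p => Nat.lt_succ_of_le (heightFn_le n S p t _)
    have hcheb := sub_one_mul_sum_pow_mul_le (n + 1)
      (fun k => ((Ω.filter fun p => N p = k).card : ℝ))
      (fun k => ((Ω'.filter fun p => N p = k).card : ℝ)) (fun k l hkl => by
        have h := card_heightFn_mul_le Ω hΩ hfg t w hkl
        have e : ∀ k, Ω'.filter (fun p => N p = k) = Ω.filter fun p =>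
            heightFn n S p t (w + 1) = k ∧ heightFn n S p t w = k + 1 := fun k => by
          rw [hΩ', Finset.filter_filter]
          refine Finset.filter_congr fun p _ => ?_
          simp only [hN]
          omega
        simp only [e]
        exact_mod_cast h) hz
    have hconst : ∀ s : Finset (Fin n → Fin (S + 1) → ℤ),
        ∑ k ∈ Finset.range (n + 1), ((s.filter fun p => N p = k).card : ℝ) = s.card :=
      fun s => by
        simpa using (sum_eq_sum_range_card_mul s N (n + 1) (fun p _ => hNM p) fun _ => 1).symm
    rw [← sum_eq_sum_range_card_mul Ω N (n + 1) (fun p _ => hNM p) (fun k => z ^ k),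
      ← sum_eq_sum_range_card_mul Ω' N (n + 1) (fun p _ => hNM p) (fun k => z ^ k),
      hconst, hconst] at hcheb
    rw [hstep fun k => z ^ k, hstep fun k => (k : ℝ)]
    have e1 : ∑ p ∈ Ω', (z ^ (N p + 1) - z ^ N p) = (z - 1) * ∑ p ∈ Ω', z ^ N p := by
      rw [Finset.mul_sum]
      exact Finset.sum_congr rfl fun p _ => by ring
    have e2 : ∑ p ∈ Ω', (((N p + 1 : ℕ) : ℝ) - (N p : ℝ)) = Ω'.card := by simp
    rw [e1, e2, add_div, mul_add, exp_add, ← mul_assoc]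
    set ρ : ℝ := Ω'.card / Ω.card
    have hρ : (Ω'.card : ℝ) = ρ * Ω.card := by simp only [ρ]; field_simp
    have hG : 0 ≤ ∑ p ∈ Ω, z ^ N p := Finset.sum_nonneg fun p _ => pow_nonneg hz _
    have hmain : (z - 1) * ∑ p ∈ Ω', z ^ N p ≤ (∑ p ∈ Ω, z ^ N p) * ((z - 1) * ρ) := by
      rw [hρ] at hcheb
      refine le_of_mul_le_mul_right ?_ hZ
      linarith
    calc (∑ p ∈ Ω, z ^ N p) + (z - 1) * ∑ p ∈ Ω', z ^ N p
        ≤ (∑ p ∈ Ω, z ^ N p) * ((z - 1) * ρ + 1) := by linarith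
      _ ≤ (∑ p ∈ Ω, z ^ N p) * exp ((z - 1) * ρ) :=
          mul_le_mul_of_nonneg_left (add_one_le_exp _) hG
      _ ≤ _ := mul_le_mul_of_nonneg_right ih (exp_pos _).le

end Concentration

/-- Exponential Markov inequality for a finite uniform measure. -/
lemma card_filter_le_mul_exp {α : Type*} (s : Finset α) (N : α → ℕ) (Q : α → Prop)
    [DecidablePred Q] {θ c C : ℝ} (hQ : ∀ p ∈ s, Q p → c ≤ θ * N p)
    (hC : ∑ p ∈ s, exp θ ^ N p ≤ C) : ((s.filter Q).card : ℝ) ≤ C * exp (-c) := by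
  have h : ((s.filter Q).card : ℝ) * exp c ≤ C := by
    refine le_trans ?_ hC
    rw [← nsmul_eq_mul]
    refine (Finset.card_nsmul_le_sum (s.filter Q) (fun p => exp θ ^ N p) _ fun p hp => ?_).trans
      (Finset.sum_le_sum_of_subset_of_nonneg (Finset.filter_subset _ _)
        fun _ _ _ => pow_nonneg (exp_pos _).le _)
    rw [Finset.mem_filter] at hp
    rw [← exp_nat_mul, mul_comm]
    exact exp_le_exp.2 (hQ p hp.1 hp.2)
  rw [exp_neg, ← div_eq_mul_inv]
  exact (le_div_iff₀ (exp_pos c)).2 h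

/-- Two-sided Gaussian deviation bound for a sub-Poissonian counting variable, up to the event
that it exceeds `B`. -/
lemma card_filter_deviation_le {α : Type*} (s : Finset α) (N : α → ℕ) {B μ d : ℝ}
    (hB0 : 0 < B) (hμ0 : 0 ≤ μ) (hd0 : 0 < d)
    (hpois : ∀ z : ℝ, 0 ≤ z → ∑ p ∈ s, z ^ N p ≤ s.card * exp ((z - 1) * μ))
    [DecidablePred fun p => d ≤ |(N p : ℝ) - min μ B|] [DecidablePred fun p => B < (N p : ℝ)] :
    ((s.filter fun p => d ≤ |(N p : ℝ) - min μ B|).card : ℝ) ≤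
      2 * (s.card * exp (-d ^ 2 / (4 * B))) + (s.filter fun p => B < (N p : ℝ)).card := by
  classical
  set θ : ℝ := d / (2 * B) with hθ
  have hθ0 : 0 < θ := by positivity
  have hθd : B * θ ^ 2 - θ * d = -d ^ 2 / (4 * B) := by
    rw [hθ]
    field_simp
    ring
  have hs : (0 : ℝ) ≤ s.card := Nat.cast_nonneg _
  have hlow : ((s.filter fun p => (N p : ℝ) ≤ min μ B - d).card : ℝ) ≤
      s.card * exp (-d ^ 2 / (4 * B)) := by
    by_cases hY : min μ B < d
    · rw [Finset.filter_eq_empty_iff.2 fun p _ => ?_]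
      · simpa using mul_nonneg hs (exp_pos _).le
      · have : (0 : ℝ) ≤ N p := Nat.cast_nonneg _
        linarith
    have hdB : d ≤ B := (not_lt.1 hY).trans (min_le_right _ _)
    have hθ1 : θ ≤ 1 := by rw [hθ, div_le_one (by positivity)]; linarith
    refine (card_filter_le_mul_exp s N _ (θ := -θ) (c := -θ * (min μ B - d))
      (fun p _ hp => by nlinarith) (hpois _ (exp_pos _).le)).trans ?_
    rw [mul_assoc, ← exp_add, ← hθd]
    refine mul_le_mul_of_nonneg_left (exp_le_exp.2 ?_) hs
    have h1 : exp (-θ) - 1 ≤ 0 := by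
      have := exp_le_one_iff.2 (neg_nonpos.2 hθ0.le)
      linarith
    have h2 := (abs_le.1 (abs_exp_sub_one_sub_id_le (x := -θ)
      (by rw [abs_neg, abs_of_pos hθ0]; exact hθ1))).2
    nlinarith [min_le_left μ B, min_le_right μ B, sq_nonneg θ,
      mul_le_mul_of_nonpos_left (min_le_left μ B) h1]
  have hupp : ((s.filter fun p => min μ B + d ≤ (N p : ℝ) ∧ (N p : ℝ) ≤ B).card : ℝ) ≤
      s.card * exp (-d ^ 2 / (4 * B)) := by
    by_cases hY : B < min μ B + d
    · rw [Finset.filter_eq_empty_iff.2 fun p _ => ?_]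
      · simpa using mul_nonneg hs (exp_pos _).le
      · rintro ⟨h1, h2⟩
        linarith
    rw [not_lt] at hY
    have hμ : μ < B := by
      by_contra h
      rw [min_eq_right (not_lt.1 h)] at hY
      linarith
    rw [min_eq_left hμ.le] at hY ⊢
    have hθ1 : θ ≤ 1 := by rw [hθ, div_le_one (by positivity)]; linarith
    refine (card_filter_le_mul_exp s N _ (θ := θ) (c := θ * (μ + d))
      (fun p _ hp => mul_le_mul_of_nonneg_left hp.1 hθ0.le) (hpois _ (exp_pos _).le)).trans ?_
    rw [mul_assoc, ← exp_add, ← hθd]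
    refine mul_le_mul_of_nonneg_left (exp_le_exp.2 ?_) hs
    have h2 := (abs_le.1 (abs_exp_sub_one_sub_id_le (x := θ)
      (by rw [abs_of_pos hθ0]; exact hθ1))).2
    nlinarith [mul_le_mul_of_nonneg_left h2 hμ0, mul_le_mul_of_nonneg_right hμ.le (sq_nonneg θ)]
  have hsub : (s.filter fun p => d ≤ |(N p : ℝ) - min μ B|) ⊆
      ((s.filter fun p => (N p : ℝ) ≤ min μ B - d) ∪
        (s.filter fun p => min μ B + d ≤ (N p : ℝ) ∧ (N p : ℝ) ≤ B)) ∪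
        s.filter fun p => B < (N p : ℝ) := fun p hp => by
    simp only [Finset.mem_union, Finset.mem_filter] at hp ⊢
    obtain ⟨hps, hp⟩ := hp
    simp only [hps, true_and]
    rcases lt_or_ge B (N p : ℝ) with h | h
    · exact Or.inr h
    rcases le_abs.1 hp with h' | h'
    · exact Or.inl (Or.inr ⟨by linarith, h⟩)
    · exact Or.inl (Or.inl (by linarith))
  have hcard := (Finset.card_le_card hsub).trans ((Finset.card_union_le _ _).trans
    (Nat.add_le_add_right (Finset.card_union_le _ _) _))
  have hcard' : ((s.filter fun p => d ≤ |(N p : ℝ) - min μ B|).card : ℝ) ≤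
      (s.filter fun p => (N p : ℝ) ≤ min μ B - d).card +
        (s.filter fun p => min μ B + d ≤ (N p : ℝ) ∧ (N p : ℝ) ≤ B).card +
        (s.filter fun p => B < (N p : ℝ)).card := by exact_mod_cast hcard
  linarith

/-- Concentration for the height function of uniformly random non-intersecting discrete
paths, with probabilities expressed as ratios of cardinalities for the uniform measure. -/
theorem statement14 (n S : ℕ) (hn : 1 ≤ n) (hS : 1 ≤ S)
    (B : ℝ) (hB : 1 ≤ B)
    (u v : Fin n → ℤ)
    (hu : ∀ i j : Fin n, i < j → u j < u i) (hv : ∀ i j : Fin n, i < j → v j < v i)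
    (f g : ℕ → ℤ) (hfg : ∀ s ≤ S, f s ≤ g s)
    (hne : {p : Fin n → Fin (S + 1) → ℤ | IsPathEnsemble n S u v f g p}.Nonempty)
    (t : Fin (S + 1)) (w : ℤ) :
    ∃ Y : ℝ, Y ∈ Icc (0 : ℝ) (n : ℝ) ∧
      ∀ r : ℝ, 1 ≤ r →
        (({p : Fin n → Fin (S + 1) → ℤ | IsPathEnsemble n S u v f g p ∧
              r * Real.sqrt B ≤ |(heightFn n S p t w : ℝ) - Y|}.ncard : ℝ) /
            ({p : Fin n → Fin (S + 1) → ℤ | IsPathEnsemble n S u v f g p}.ncard : ℝ))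
          ≤ 2 * Real.exp (-r ^ 2 / 4) +
            2 * (({p : Fin n → Fin (S + 1) → ℤ | IsPathEnsemble n S u v f g p ∧
                B < (heightFn n S p t w : ℝ)}.ncard : ℝ) /
              ({p : Fin n → Fin (S + 1) → ℤ | IsPathEnsemble n S u v f g p}.ncard : ℝ)) := by
  classical
  have hfin := IsPathEnsemble.finite n S u v f g
  set Ω := hfin.toFinset
  have hΩ : ∀ p, p ∈ Ω ↔ IsPathEnsemble n S u v f g p := fun p => hfin.mem_toFinset
  have hΩne : Ω.Nonempty := hfin.toFinset_nonempty.2 hne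
  have hZ : (0 : ℝ) < Ω.card := by exact_mod_cast hΩne.card_pos
  have hncard : ∀ Q : (Fin n → Fin (S + 1) → ℤ) → Prop,
      {p | IsPathEnsemble n S u v f g p ∧ Q p}.ncard = (Ω.filter Q).card := fun Q => by
    rw [← Set.ncard_coe_finset]
    congr 1
    ext p
    simp [hΩ]
  have hncardΩ : {p | IsPathEnsemble n S u v f g p}.ncard = Ω.card :=
    Set.ncard_eq_toFinset_card _ hfin
  set μ : ℝ := (∑ p ∈ Ω, (heightFn n S p t w : ℝ)) / Ω.card with hμ
  have hμ0 : 0 ≤ μ := by positivity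
  have hμn : μ ≤ n := by
    rw [hμ, div_le_iff₀ hZ, mul_comm, ← nsmul_eq_mul]
    exact Finset.sum_le_card_nsmul _ _ _ fun p _ => by exact_mod_cast heightFn_le n S p t w
  refine ⟨min μ B, ⟨le_min hμ0 (by linarith), (min_le_left _ _).trans hμn⟩, fun r hr => ?_⟩
  have hB0 : 0 < B := by linarith
  have hdev := card_filter_deviation_le Ω (fun p => heightFn n S p t w) (d := r * √B) hB0 hμ0
    (by positivity) fun z hz => sum_pow_heightFn_le Ω hΩ hΩne hfg t w hz
  have hexp : -(r * √B) ^ 2 / (4 * B) = -r ^ 2 / 4 := by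
    rw [mul_pow, sq_sqrt hB0.le]
    field_simp
  rw [hexp] at hdev
  rw [hncard, hncard, hncardΩ, ← mul_div_assoc, div_le_iff₀ hZ, add_mul,
    div_mul_cancel₀ _ hZ.ne']
  have h0 : (0 : ℝ) ≤ (Ω.filter fun p => B < (heightFn n S p t w : ℝ)).card := Nat.cast_nonneg _
  linarith
end
end

section
/- Fix an integer m ≥ 1 and m pairs of real numbers (q₀^{(k)}, q₁^{(k)}), k = 1, …, m, with q₀^{(1)} < 0. Then: (1) there is a unique consistent array Q = (q_j^{(k)})_{1≤k≤m, 0≤j≤k} such that for each k its entries in positions j = 0 and j = 1 are the given q₀^{(k)} and q₁^{(k)}; (2) for any reals ε ∈ (0,1) and B > 1 there exists a constant C > 1, depending only on (ε, B, m), such that if in addition q₀^{(1)} ≤ −ε and max_{1≤k≤m}(|q₀^{(k)}| + |q₁^{(k)}|) ≤ B, then every entry of this array satisfies |q_j^{(k)}| ≤ C. -/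
open Real Set MeasureTheory Filter
open scoped ENNReal

noncomputable section

/-- The polynomial `A_Q(t,x) = ∑_{k=1}^m ∑_{j=0}^k (q_j^{(k)}/(j!(k−j)!)) t^j x^{k−j}`
associated with an array `Q = (q k j)`. -/
def AQ (m : ℕ) (q : ℕ → ℕ → ℝ) : ℝ × ℝ → ℝ := fun z =>
  ∑ k ∈ Finset.Icc 1 m, ∑ j ∈ Finset.range (k + 1),
    (q k j / ((Nat.factorial j : ℝ) * (Nat.factorial (k - j) : ℝ))) * z.1 ^ j * z.2 ^ (k - j)

/-- The function `D_Q` obtained by applying the operator of equation (B) to `A_Q`. -/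
def DQ (m : ℕ) (q : ℕ → ℕ → ℝ) : ℝ × ℝ → ℝ := fun z => BExpr (AQ m q) z

/-- The array `Q = (q k j)` (entries with `1 ≤ k ≤ m`, `0 ≤ j ≤ k` being relevant)
is consistent: `q_0^{(1)} < 0` and `∂_t^i ∂_x^j D_Q(0,0) = 0` whenever `i + j ≤ m − 2`. -/
def ConsistentArr (m : ℕ) (q : ℕ → ℕ → ℝ) : Prop :=
  q 1 0 < 0 ∧ ∀ i j : ℕ, i + j + 2 ≤ m → pdIter (DQ m q) i j (0, 0) = 0

/-- `q` is the consistent extension of the sequence of pairs `(q0 k, q1 k)`, `1 ≤ k ≤ m`. -/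
def IsConsistentExtension (m : ℕ) (q0 q1 : ℕ → ℝ) (q : ℕ → ℕ → ℝ) : Prop :=
  ConsistentArr m q ∧ ∀ k, 1 ≤ k → k ≤ m → q k 0 = q0 k ∧ q k 1 = q1 k

open MvPolynomial in
/-- Differentiating the evaluation of a polynomial in one coordinate amounts to `pderiv`. -/
lemma hasDerivAt_eval_update {σ : Type*} [DecidableEq σ] (p : MvPolynomial σ ℝ) (v : σ → ℝ)
    (i : σ) (s : ℝ) :
    HasDerivAt (fun s => eval (Function.update v i s) p)
      (eval (Function.update v i s) (pderiv i p)) s := by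
  induction p using MvPolynomial.induction_on with
  | C a => simpa using hasDerivAt_const s a
  | add p q hp hq =>
    simp only [map_add]
    exact hp.add hq
  | mul_X p j hp =>
    have hX : HasDerivAt (fun s => Function.update v i s j)
        (eval (Function.update v i s) (pderiv i (X j : MvPolynomial σ ℝ))) s := by
      by_cases h : j = i
      · subst h
        simpa using hasDerivAt_id' s
      · simpa [Function.update_of_ne h, pderiv_X_of_ne h] using hasDerivAt_const s (v j)
    simp only [map_mul, eval_X, pderiv_mul, map_add]
    exact hp.mul hX

/-- The function on the plane defined by a polynomial in two variables. -/
def evalPlane (p : MvPolynomial (Fin 2) ℝ) : ℝ × ℝ → ℝ := fun z =>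
  MvPolynomial.eval ![z.1, z.2] p

lemma pdT_evalPlane (p : MvPolynomial (Fin 2) ℝ) :
    pdT (evalPlane p) = evalPlane (MvPolynomial.pderiv 0 p) := by
  funext z
  have h := (hasDerivAt_eval_update p ![z.1, z.2] 0 z.1).deriv
  have hu : ∀ s, Function.update ![z.1, z.2] 0 s = ![s, z.2] := fun s => by
    ext a; fin_cases a <;> simp
  simp only [hu] at h
  exact h

lemma pdX_evalPlane (p : MvPolynomial (Fin 2) ℝ) :
    pdX (evalPlane p) = evalPlane (MvPolynomial.pderiv 1 p) := by
  funext z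
  have h := (hasDerivAt_eval_update p ![z.1, z.2] 1 z.2).deriv
  have hu : ∀ s, Function.update ![z.1, z.2] 1 s = ![z.1, s] := fun s => by
    ext a; fin_cases a <;> simp
  simp only [hu] at h
  exact h

/-- The exponent of the monomial `t ^ i * x ^ j`. -/
def planeExp (i j : ℕ) : Fin 2 →₀ ℕ := Finsupp.single 0 i + Finsupp.single 1 j

@[simp]
lemma planeExp_zero (i j : ℕ) : planeExp i j 0 = i := by simp [planeExp]

@[simp]
lemma planeExp_one (i j : ℕ) : planeExp i j 1 = j := by simp [planeExp]

lemma eq_planeExp (d : Fin 2 →₀ ℕ) : d = planeExp (d 0) (d 1) := by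
  ext a; fin_cases a <;> simp

lemma planeExp_add_single_zero (i j : ℕ) :
    planeExp i j + Finsupp.single 0 1 = planeExp (i + 1) j := by
  ext a; fin_cases a <;> simp

lemma planeExp_add_single_one (i j : ℕ) :
    planeExp i j + Finsupp.single 1 1 = planeExp i (j + 1) := by
  ext a; fin_cases a <;> simp

lemma coeff_pderiv_zero (p : MvPolynomial (Fin 2) ℝ) (i j : ℕ) :
    (MvPolynomial.pderiv 0 p).coeff (planeExp i j) =
      p.coeff (planeExp (i + 1) j) * (i + 1) := by
  rw [MvPolynomial.coeff_pderiv, planeExp_add_single_zero, planeExp_zero]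

lemma coeff_pderiv_one (p : MvPolynomial (Fin 2) ℝ) (i j : ℕ) :
    (MvPolynomial.pderiv 1 p).coeff (planeExp i j) =
      p.coeff (planeExp i (j + 1)) * (j + 1) := by
  rw [MvPolynomial.coeff_pderiv, planeExp_add_single_one, planeExp_one]

lemma pdIter_evalPlane_zero (p : MvPolynomial (Fin 2) ℝ) (i j : ℕ) :
    pdIter (evalPlane p) i j (0, 0) =
      (Nat.factorial i : ℝ) * (Nat.factorial j : ℝ) * p.coeff (planeExp i j) := by
  have hX : ∀ (j : ℕ) (p : MvPolynomial (Fin 2) ℝ), ∃ r, pdX^[j] (evalPlane p) = evalPlane r ∧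
      ∀ i, r.coeff (planeExp i 0) = (Nat.factorial j : ℝ) * p.coeff (planeExp i j) := by
    intro j
    induction j with
    | zero => exact fun p => ⟨p, rfl, by simp⟩
    | succ j ih =>
      intro p
      obtain ⟨r, hr, hc⟩ := ih (MvPolynomial.pderiv 1 p)
      refine ⟨r, by rw [Function.iterate_succ_apply, pdX_evalPlane, hr], fun i => ?_⟩
      rw [hc, coeff_pderiv_one, Nat.factorial_succ]
      push_cast
      ring
  have hT : ∀ (i : ℕ) (p : MvPolynomial (Fin 2) ℝ), pdT^[i] (evalPlane p) (0, 0) =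
      (Nat.factorial i : ℝ) * p.coeff (planeExp i 0) := by
    intro i
    induction i with
    | zero =>
      intro p
      have h0 : (![(0 : ℝ), 0] : Fin 2 → ℝ) = 0 := by ext a; fin_cases a <;> rfl
      simp [evalPlane, h0, planeExp, MvPolynomial.eval_zero, MvPolynomial.constantCoeff_eq]
    | succ i ih =>
      intro p
      rw [Function.iterate_succ_apply, pdT_evalPlane, ih, coeff_pderiv_zero, Nat.factorial_succ]
      push_cast
      ring
  obtain ⟨r, hr, hc⟩ := hX j p
  rw [pdIter, hr, hT, hc, mul_assoc]

/-- The polynomial whose associated function is `AQ m q`. -/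
def arrayPoly (m : ℕ) (q : ℕ → ℕ → ℝ) : MvPolynomial (Fin 2) ℝ :=
  ∑ k ∈ Finset.Icc 1 m, ∑ j ∈ Finset.range (k + 1),
    MvPolynomial.monomial (planeExp j (k - j))
      (q k j / ((Nat.factorial j : ℝ) * (Nat.factorial (k - j) : ℝ)))

lemma evalPlane_arrayPoly (m : ℕ) (q : ℕ → ℕ → ℝ) : evalPlane (arrayPoly m q) = AQ m q := by
  funext z
  simp [evalPlane, arrayPoly, AQ, MvPolynomial.eval_monomial, Finsupp.prod_fintype, mul_assoc]

lemma coeff_arrayPoly (m : ℕ) (q : ℕ → ℕ → ℝ) (i j : ℕ) :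
    (arrayPoly m q).coeff (planeExp i j) =
      if 1 ≤ i + j ∧ i + j ≤ m then
        q (i + j) i / ((Nat.factorial i : ℝ) * (Nat.factorial j : ℝ)) else 0 := by
  have hexp : ∀ a b, planeExp a b = planeExp i j ↔ a = i ∧ b = j := by
    refine fun a b => ⟨fun h => ⟨?_, ?_⟩, by rintro ⟨rfl, rfl⟩; rfl⟩
    · simpa using DFunLike.congr_fun h 0
    · simpa using DFunLike.congr_fun h 1
  have hin : ∀ k, (∑ a ∈ Finset.range (k + 1), if planeExp a (k - a) = planeExp i j then
      q k a / ((Nat.factorial a : ℝ) * (Nat.factorial (k - a) : ℝ)) else 0) =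
      if k = i + j then
        q (i + j) i / ((Nat.factorial i : ℝ) * (Nat.factorial j : ℝ)) else 0 := by
    intro k
    split_ifs with hk
    · subst hk
      rw [Finset.sum_eq_single i]
      · simp
      · intro b _ hb
        rw [if_neg]
        rw [hexp]
        tauto
      · intro h
        simp only [Finset.mem_range] at h
        omega
    · refine Finset.sum_eq_zero fun a ha => if_neg ?_
      rw [hexp]
      simp only [Finset.mem_range] at ha
      omega
  simp only [arrayPoly, MvPolynomial.coeff_sum, MvPolynomial.coeff_monomial, hin]
  rw [Finset.sum_ite_eq']
  simp [Finset.mem_Icc]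

open MvPolynomial in
/-- The operator of equation (B) acting on polynomials. -/
def polyB (p : MvPolynomial (Fin 2) ℝ) : MvPolynomial (Fin 2) ℝ :=
  pderiv 1 p ^ 2 * pderiv 0 (pderiv 0 p) -
      2 * pderiv 0 p * pderiv 1 p * pderiv 0 (pderiv 1 p) +
    (pderiv 0 p ^ 2 + C (π ^ 2) * pderiv 1 p ^ 4) * pderiv 1 (pderiv 1 p)

lemma evalPlane_polyB (m : ℕ) (q : ℕ → ℕ → ℝ) :
    evalPlane (polyB (arrayPoly m q)) = DQ m q := by
  funext z
  simp only [DQ, BExpr, ← evalPlane_arrayPoly, pdX_evalPlane, pdT_evalPlane]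
  simp [evalPlane, polyB]

/-- The quantity `∂_t^i ∂_x^j D_Q(0,0)`. -/
def jetB (m i j : ℕ) (q : ℕ → ℕ → ℝ) : ℝ := pdIter (DQ m q) i j (0, 0)

lemma jetB_eq (m i j : ℕ) (q : ℕ → ℕ → ℝ) :
    jetB m i j q = (Nat.factorial i : ℝ) * (Nat.factorial j : ℝ) *
      (polyB (arrayPoly m q)).coeff (planeExp i j) := by
  rw [jetB, ← evalPlane_polyB, pdIter_evalPlane_zero]

/-- A family of polynomials all of whose coefficients depend continuously on the parameter. -/
def CoeffContinuous {Y : Type*} [TopologicalSpace Y] (f : Y → MvPolynomial (Fin 2) ℝ) : Prop :=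
  ∀ d, Continuous fun y => (f y).coeff d

namespace CoeffContinuous

variable {Y : Type*} [TopologicalSpace Y] {f g : Y → MvPolynomial (Fin 2) ℝ}

lemma const (p : MvPolynomial (Fin 2) ℝ) : CoeffContinuous fun _ : Y => p :=
  fun _ => continuous_const

lemma add (hf : CoeffContinuous f) (hg : CoeffContinuous g) :
    CoeffContinuous fun y => f y + g y := fun d => by
  simp only [MvPolynomial.coeff_add]
  exact (hf d).add (hg d)

lemma sub (hf : CoeffContinuous f) (hg : CoeffContinuous g) :
    CoeffContinuous fun y => f y - g y := fun d => by
  simp only [MvPolynomial.coeff_sub]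
  exact (hf d).sub (hg d)

lemma mul (hf : CoeffContinuous f) (hg : CoeffContinuous g) :
    CoeffContinuous fun y => f y * g y := fun d => by
  simp only [MvPolynomial.coeff_mul]
  exact continuous_finsetSum _ fun x _ => (hf x.1).mul (hg x.2)

lemma pow (hf : CoeffContinuous f) (n : ℕ) : CoeffContinuous fun y => f y ^ n := by
  induction n with
  | zero => simpa using const 1
  | succ n ih => simpa only [pow_succ] using ih.mul hf

lemma pderiv (hf : CoeffContinuous f) (a : Fin 2) :
    CoeffContinuous fun y => MvPolynomial.pderiv a (f y) := fun d => by
  simp only [MvPolynomial.coeff_pderiv]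
  exact (hf _).mul continuous_const

lemma polyB (hf : CoeffContinuous f) : CoeffContinuous fun y => polyB (f y) :=
  ((((hf.pderiv 1).pow 2).mul ((hf.pderiv 0).pderiv 0)).sub
    ((((const 2).mul (hf.pderiv 0)).mul (hf.pderiv 1)).mul ((hf.pderiv 1).pderiv 0))).add
    ((((hf.pderiv 0).pow 2).add ((const _).mul ((hf.pderiv 1).pow 4))).mul
      ((hf.pderiv 1).pderiv 1))

end CoeffContinuous

lemma coeffContinuous_arrayPoly (m : ℕ) : CoeffContinuous (arrayPoly m) := fun d => by
  rw [eq_planeExp d]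
  simp only [coeff_arrayPoly]
  split_ifs <;> fun_prop

lemma continuous_jetB (m i j : ℕ) : Continuous (jetB m i j) := by
  have h := (coeffContinuous_arrayPoly m).polyB (planeExp i j)
  rw [show jetB m i j = _ from funext (jetB_eq m i j)]
  exact continuous_const.mul h

/-- If `r` vanishes to order `i + j` at the origin, the coefficient of `t ^ i * x ^ j` in `p * r`
only sees the constant term of `p`. -/
lemma coeff_mul_of_vanishing (p : MvPolynomial (Fin 2) ℝ) {r : MvPolynomial (Fin 2) ℝ} {i j : ℕ}
    (hr : ∀ a b, a + b < i + j → r.coeff (planeExp a b) = 0) :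
    (p * r).coeff (planeExp i j) = p.coeff 0 * r.coeff (planeExp i j) := by
  rw [MvPolynomial.coeff_mul, Finset.sum_eq_single (0, planeExp i j)]
  · rintro ⟨d, e⟩ hde hne
    rw [Finset.HasAntidiagonal.mem_antidiagonal] at hde
    rw [eq_planeExp e, hr, mul_zero]
    have h0 : d 0 + e 0 = i := by simpa using DFunLike.congr_fun hde 0
    have h1 : d 1 + e 1 = j := by simpa using DFunLike.congr_fun hde 1
    by_contra hlt
    have hd : d = 0 := by ext a; fin_cases a <;> simp <;> omega
    subst hd
    exact hne (by simpa using hde)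
  · simp

open MvPolynomial in
/-- Effect on a coefficient of `polyB p` of a perturbation of `p` in its top-order part. -/
lemma coeff_polyB_add (p r : MvPolynomial (Fin 2) ℝ) {i j : ℕ}
    (hr : ∀ a b, a + b < i + j + 2 → r.coeff (planeExp a b) = 0)
    (hr₁ : r.coeff (planeExp (i + 1) (j + 1)) = 0) (hr₂ : r.coeff (planeExp i (j + 2)) = 0) :
    (polyB (p + r)).coeff (planeExp i j) = (polyB p).coeff (planeExp i j) +
      p.coeff (planeExp 0 1) ^ 2 * (r.coeff (planeExp (i + 2) j) * (i + 2) * (i + 1)) := by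
  set P := pderiv 0 p with hP
  set S := pderiv 1 p with hS
  set R := pderiv 0 r with hR
  set U := pderiv 1 r with hU
  have hR0 : ∀ a b, a + b < i + j + 1 → R.coeff (planeExp a b) = 0 := fun a b h => by
    rw [hR, coeff_pderiv_zero, hr _ _ (by omega), zero_mul]
  have hU0 : ∀ a b, a + b < i + j + 1 → U.coeff (planeExp a b) = 0 := fun a b h => by
    rw [hU, coeff_pderiv_one, hr _ _ (by omega), zero_mul]
  have hRz : ∀ w, (w * R).coeff (planeExp i j) = 0 := fun w => by
    rw [coeff_mul_of_vanishing w fun a b h => hR0 a b (by omega), hR0 i j (by omega), mul_zero]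
  have hUz : ∀ w, (w * U).coeff (planeExp i j) = 0 := fun w => by
    rw [coeff_mul_of_vanishing w fun a b h => hU0 a b (by omega), hU0 i j (by omega), mul_zero]
  have hTX : ∀ w, (w * pderiv 0 U).coeff (planeExp i j) = 0 := fun w => by
    rw [coeff_mul_of_vanishing w fun a b h => by
      rw [coeff_pderiv_zero, hU0 _ _ (by omega), zero_mul], coeff_pderiv_zero, hU,
      coeff_pderiv_one, hr₁]
    ring
  have hXX : ∀ w, (w * pderiv 1 U).coeff (planeExp i j) = 0 := fun w => by
    rw [coeff_mul_of_vanishing w fun a b h => by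
      rw [coeff_pderiv_one, hU0 _ _ (by omega), zero_mul], coeff_pderiv_one, hU,
      coeff_pderiv_one, hr₂]
    ring
  have hSc : S.coeff 0 = p.coeff (planeExp 0 1) := by
    have := coeff_pderiv_one p 0 0
    simpa [planeExp] using this
  have hTT : (S ^ 2 * pderiv 0 R).coeff (planeExp i j) =
      p.coeff (planeExp 0 1) ^ 2 * (r.coeff (planeExp (i + 2) j) * (i + 2) * (i + 1)) := by
    rw [coeff_mul_of_vanishing (S ^ 2) fun a b h => by
      rw [coeff_pderiv_zero, hR0 _ _ (by omega), zero_mul], coeff_pderiv_zero, hR,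
      coeff_pderiv_zero, ← constantCoeff_eq, map_pow, constantCoeff_eq, hSc]
    push_cast
    ring
  have key : polyB (p + r) = polyB p + S ^ 2 * pderiv 0 R
      + (-2 * P * S) * pderiv 0 U
      + (P ^ 2 + C (π ^ 2) * S ^ 4) * pderiv 1 U
      + ((2 * S + U) * (pderiv 0 P + pderiv 0 R) - 2 * P * (pderiv 0 S + pderiv 0 U)
        + C (π ^ 2) * (4 * S ^ 3 + 6 * S ^ 2 * U + 4 * S * U ^ 2 + U ^ 3)
          * (pderiv 1 S + pderiv 1 U)) * U
      + (-2 * (S + U) * (pderiv 0 S + pderiv 0 U)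
        + (2 * P + R) * (pderiv 1 S + pderiv 1 U)) * R := by
    simp only [polyB, map_add, ← hP, ← hS, ← hR, ← hU]
    ring
  rw [key]
  simp only [coeff_add, hRz, hUz, hTX, hXX, hTT, add_zero]

/-- The array `q` with all entries at positions from `(k, j)` on, in lexicographic order, and all
entries outside the triangle replaced by zero. -/
def truncArr (k j : ℕ) (q : ℕ → ℕ → ℝ) : ℕ → ℕ → ℝ := fun k' j' =>
  if (k' < k ∨ k' = k ∧ j' < j) ∧ 1 ≤ k' ∧ j' ≤ k' then q k' j' else 0

/-- The coefficient `q_{i+2}^{(i+j+2)}` enters `∂_t^i ∂_x^j D_Q(0,0)` linearly, and all other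
entries occurring there precede it lexicographically. -/
lemma jetB_eq_add_truncArr {m i j : ℕ} (h : i + j + 2 ≤ m) (q : ℕ → ℕ → ℝ) :
    jetB m i j q = q 1 0 ^ 2 * q (i + j + 2) (i + 2) +
      jetB m i j (truncArr (i + j + 2) (i + 2) q) := by
  set q' := truncArr (i + j + 2) (i + 2) q with hq'
  set p := arrayPoly m q' with hp
  have hdiff : ∀ a b, (a + b < i + j + 2 ∨ a + b = i + j + 2 ∧ a < i + 2) →
      (arrayPoly m q - p).coeff (planeExp a b) = 0 := by
    intro a b hab
    rw [MvPolynomial.coeff_sub, hp, coeff_arrayPoly, coeff_arrayPoly]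
    split_ifs with hm
    · rw [hq', truncArr, if_pos ⟨hab, hm.1, by omega⟩, sub_self]
    · exact sub_self 0
  have hE := coeff_polyB_add p (arrayPoly m q - p) (i := i) (j := j)
    (fun a b hab => hdiff a b (Or.inl hab)) (hdiff _ _ (by omega)) (hdiff _ _ (by omega))
  have hp1 : p.coeff (planeExp 0 1) = q 1 0 := by
    rw [hp, coeff_arrayPoly, if_pos (by omega)]
    simp [hq', truncArr]
  have htop : (arrayPoly m q - p).coeff (planeExp (i + 2) j) =
      q (i + j + 2) (i + 2) / ((Nat.factorial (i + 2) : ℝ) * (Nat.factorial j : ℝ)) := by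
    rw [MvPolynomial.coeff_sub, hp, coeff_arrayPoly, coeff_arrayPoly, if_pos (by omega),
      if_pos (by omega), show i + 2 + j = i + j + 2 by omega]
    simp [hq', truncArr]
  rw [add_sub_cancel, hp1, htop] at hE
  rw [jetB_eq, jetB_eq, hE, Nat.factorial_succ, Nat.factorial_succ]
  have hi : (Nat.factorial i : ℝ) ≠ 0 := by positivity
  have hj : (Nat.factorial j : ℝ) ≠ 0 := by positivity
  have h1 : (i : ℝ) + 1 ≠ 0 := by positivity
  have h2 : (i : ℝ) + 2 ≠ 0 := by positivity
  push_cast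
  rw [show (i : ℝ) + 1 + 1 = i + 2 by ring]
  field_simp
  ring

/-- Recursion solved by the entries of a consistent array. -/
lemma ConsistentArr.apply_add_two {m : ℕ} {q : ℕ → ℕ → ℝ} (hq : ConsistentArr m q) {k j : ℕ}
    (hk : k ≤ m) (hj : j + 2 ≤ k) :
    q k (j + 2) = -jetB m j (k - (j + 2)) (truncArr k (j + 2) q) / q 1 0 ^ 2 := by
  have h := jetB_eq_add_truncArr (m := m) (i := j) (j := k - (j + 2)) (by omega) q
  rw [show j + (k - (j + 2)) + 2 = k by omega, jetB, hq.2 _ _ (by omega)] at h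
  rw [eq_div_iff (pow_ne_zero 2 hq.1.ne)]
  linarith

/-- The consistent array with prescribed first two columns. -/
def extendArr (m : ℕ) (q0 q1 : ℕ → ℝ) : ℕ → ℕ → ℝ
  | k, 0 => q0 k
  | k, 1 => q1 k
  | k, j + 2 => -jetB m j (k - (j + 2)) (fun k' j' =>
      if _h : (k' < k ∨ k' = k ∧ j' < j + 2) ∧ 1 ≤ k' ∧ j' ≤ k' then
        extendArr m q0 q1 k' j' else 0) / q0 1 ^ 2
termination_by k j => (k, j)
decreasing_by
  rcases _h.1 with h | ⟨rfl, h⟩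
  · exact Prod.Lex.left _ _ h
  · exact Prod.Lex.right _ h

lemma isConsistentExtension_extendArr (m : ℕ) (q0 q1 : ℕ → ℝ) (h0 : q0 1 < 0) :
    IsConsistentExtension m q0 q1 (extendArr m q0 q1) := by
  have h10 : extendArr m q0 q1 1 0 = q0 1 := by rw [extendArr]
  refine ⟨⟨h10 ▸ h0, fun i j hij => ?_⟩, fun k _ _ => ⟨by rw [extendArr], by rw [extendArr]⟩⟩
  have h := jetB_eq_add_truncArr hij (extendArr m q0 q1)
  have hrec : extendArr m q0 q1 (i + j + 2) (i + 2) =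
      -jetB m i j (truncArr (i + j + 2) (i + 2) (extendArr m q0 q1)) / q0 1 ^ 2 := by
    rw [extendArr, show i + j + 2 - (i + 2) = j by omega]
    rfl
  rw [h10, hrec, mul_div_cancel₀ _ (pow_ne_zero 2 h0.ne), neg_add_cancel] at h
  exact h

/-- Induction along the lexicographic order on positions `(k, j)`. -/
lemma lex_induction {P : ℕ → ℕ → Prop}
    (h : ∀ k j, (∀ k' j', (k' < k ∨ k' = k ∧ j' < j) → P k' j') → P k j) (k j : ℕ) : P k j := by
  induction k using Nat.strong_induction_on generalizing j with
  | _ k ihk =>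
    induction j using Nat.strong_induction_on with
    | _ j ihj =>
      refine h k j fun k' j' hlt => ?_
      rcases hlt with hlt | ⟨rfl, hlt⟩
      · exact ihk k' hlt j'
      · exact ihj j' hlt

lemma IsConsistentExtension.unique {m : ℕ} (hm : 1 ≤ m) {q0 q1 : ℕ → ℝ} {q q' : ℕ → ℕ → ℝ}
    (hq : IsConsistentExtension m q0 q1 q) (hq' : IsConsistentExtension m q0 q1 q') (k j : ℕ) :
    1 ≤ k → k ≤ m → j ≤ k → q' k j = q k j := by
  refine lex_induction (P := fun k j => 1 ≤ k → k ≤ m → j ≤ k → q' k j = q k j) ?_ k j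
  intro k j ih hk1 hkm hjk
  match j with
  | 0 => rw [(hq.2 k hk1 hkm).1, (hq'.2 k hk1 hkm).1]
  | 1 => rw [(hq.2 k hk1 hkm).2, (hq'.2 k hk1 hkm).2]
  | j + 2 =>
    have htr : truncArr k (j + 2) q' = truncArr k (j + 2) q := by
      funext k' j'
      unfold truncArr
      split_ifs with h
      · exact ih k' j' h.1 h.2.1 (by omega) h.2.2
      · rfl
    rw [hq.1.apply_add_two hkm hjk, hq'.1.apply_add_two hkm hjk, htr, (hq.2 1 le_rfl hm).1,
      (hq'.2 1 le_rfl hm).1]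

/-- Each entry of a consistent array is bounded in terms of bounds on its first two columns. -/
lemma exists_bound_apply {m : ℕ} (hm : 1 ≤ m) {ε : ℝ} (hε : 0 < ε) (B : ℝ) (k j : ℕ) :
    ∃ C : ℝ, ∀ (q0 q1 : ℕ → ℝ) (q : ℕ → ℕ → ℝ), q0 1 ≤ -ε →
      (∀ k, 1 ≤ k → k ≤ m → |q0 k| + |q1 k| ≤ B) → IsConsistentExtension m q0 q1 q →
      1 ≤ k → k ≤ m → j ≤ k → |q k j| ≤ C := by
  refine lex_induction (P := fun k j => ∃ C : ℝ, ∀ (q0 q1 : ℕ → ℝ) (q : ℕ → ℕ → ℝ), q0 1 ≤ -ε →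
      (∀ k, 1 ≤ k → k ≤ m → |q0 k| + |q1 k| ≤ B) → IsConsistentExtension m q0 q1 q →
      1 ≤ k → k ≤ m → j ≤ k → |q k j| ≤ C) ?_ k j
  intro k j ih
  match j with
  | 0 =>
    refine ⟨B, fun q0 q1 q _ hB hq hk1 hkm _ => ?_⟩
    rw [(hq.2 k hk1 hkm).1]
    linarith [hB k hk1 hkm, abs_nonneg (q1 k)]
  | 1 =>
    refine ⟨B, fun q0 q1 q _ hB hq hk1 hkm _ => ?_⟩
    rw [(hq.2 k hk1 hkm).2]
    linarith [hB k hk1 hkm, abs_nonneg (q0 k)]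
  | j + 2 =>
    choose! C hC using ih
    have hcomp : IsCompact (Set.univ.pi fun k' => Set.univ.pi fun j' =>
        Set.Icc (-|C k' j'|) |C k' j'|) :=
      isCompact_univ_pi fun k' => isCompact_univ_pi fun j' => isCompact_Icc
    obtain ⟨M, hM⟩ := hcomp.exists_bound_of_continuousOn
      (continuous_jetB m j (k - (j + 2))).continuousOn
    refine ⟨M / ε ^ 2, fun q0 q1 q h0 hB hq hk1 hkm hjk => ?_⟩
    have hmem : truncArr k (j + 2) q ∈ Set.univ.pi fun k' => Set.univ.pi fun j' =>
        Set.Icc (-|C k' j'|) |C k' j'| := by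
      refine fun k' _ j' _ => abs_le.mp ?_
      unfold truncArr
      split_ifs with h
      · exact (hC k' j' h.1 q0 q1 q h0 hB hq h.2.1 (by omega) h.2.2).trans (le_abs_self _)
      · simp
    have hb := hM _ hmem
    rw [Real.norm_eq_abs] at hb
    have hsq : ε ^ 2 ≤ q 1 0 ^ 2 := by
      rw [(hq.2 1 le_rfl hm).1]
      nlinarith
    rw [hq.1.apply_add_two hkm hjk, abs_div, abs_neg, abs_of_nonneg (sq_nonneg (q 1 0))]
    exact div_le_div₀ ((abs_nonneg _).trans hb) hb (by positivity) hsq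

theorem statement16 (m : ℕ) (hm : 1 ≤ m) :
    (∀ q0 q1 : ℕ → ℝ, q0 1 < 0 →
      ∃ q : ℕ → ℕ → ℝ, IsConsistentExtension m q0 q1 q ∧
        ∀ q' : ℕ → ℕ → ℝ, IsConsistentExtension m q0 q1 q' →
          ∀ k, 1 ≤ k → k ≤ m → ∀ j ≤ k, q' k j = q k j) ∧
    (∀ ε B : ℝ, ε ∈ Ioo (0 : ℝ) 1 → 1 < B →
      ∃ C : ℝ, 1 < C ∧
        ∀ (q0 q1 : ℕ → ℝ) (q : ℕ → ℕ → ℝ),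
          q0 1 ≤ -ε → (∀ k, 1 ≤ k → k ≤ m → |q0 k| + |q1 k| ≤ B) →
          IsConsistentExtension m q0 q1 q →
          ∀ k, 1 ≤ k → k ≤ m → ∀ j ≤ k, |q k j| ≤ C) := by
  refine ⟨fun q0 q1 h0 => ⟨extendArr m q0 q1, isConsistentExtension_extendArr m q0 q1 h0,
    fun q' hq' k hk1 hkm j hjk =>
      (isConsistentExtension_extendArr m q0 q1 h0).unique hm hq' k j hk1 hkm hjk⟩,
    fun ε B hε _ => ?_⟩
  choose C hC using exists_bound_apply hm hε.1 B
  set S := ∑ k ∈ Finset.range (m + 1), ∑ j ∈ Finset.range (m + 1), |C k j| with hS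
  have hS0 : 0 ≤ S := by positivity
  refine ⟨S + 2, by linarith, fun q0 q1 q h0 hB hq k hk1 hkm j hjk => ?_⟩
  have hle : |C k j| ≤ S :=
    (Finset.single_le_sum (f := fun j => |C k j|) (fun _ _ => abs_nonneg _)
      (Finset.mem_range.mpr (by omega))).trans
    (Finset.single_le_sum (f := fun k => ∑ j ∈ Finset.range (m + 1), |C k j|)
      (fun _ _ => Finset.sum_nonneg fun _ _ => abs_nonneg _) (Finset.mem_range.mpr (by omega)))
  linarith [hC k j q0 q1 q h0 hB hq hk1 hkm hjk, le_abs_self (C k j)]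
end
end

section
/- Fix integers T, n ≥ 1 and a real B ≥ 0; n-tuples u, ũ, v, ṽ ∈ 𝕎_n; and functions f, f̃, g, g̃ : ⟦0,T⟧ → ℝ ∪ {−∞, +∞} with f ≤ g and f̃ ≤ g̃ pointwise, such that the non-intersecting Gaussian bridge measures 𝔊[u;v;f;g] and 𝔊[ũ;ṽ;f̃;g̃] are well defined. Assume u_j ≤ ũ_j ≤ u_j + B and v_j ≤ ṽ_j ≤ v_j + B for each j ∈ ⟦1,n⟧. (1) If f(t) ≤ f̃(t) ≤ f(t) + B and g(t) ≤ g̃(t) ≤ g(t) + B for each t ∈ ⟦0,T⟧, then there exists a coupling of x ∼ 𝔊[u;v;f;g] and x̃ ∼ 𝔊[ũ;ṽ;f̃;g̃] under which almost surely x_j(t) ≤ x̃_j(t) ≤ x_j(t) + B for all (j,t) ∈ ⟦1,n⟧×⟦0,T⟧. (2) If moreover u = ũ and for each t ∈ ⟦0,T⟧ one has f(t) ≤ f̃(t) ≤ f(t) + tB/T and g(t) ≤ g̃(t) ≤ g(t) + tB/T, then there exists a coupling of x and x̃ under which almost surely x_j(t) ≤ x̃_j(t) ≤ x_j(t) + tB/T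 for all (j,t) ∈ ⟦1,n⟧×⟦0,T⟧. -/
open Real Set MeasureTheory
open scoped ENNReal

noncomputable section

/-- Assemble a full trajectory on `⟦0, T⟧ ⊂ ℕ` from the vector `q` of interior values,
with starting data `u` (at time `0`) and ending data `v` (at times `≥ T`). -/
def assemblePath (n T : ℕ) (u v : Fin n → ℝ) (q : Fin n × Fin (T - 1) → ℝ) :
    Fin n → ℕ → ℝ := fun j t =>
  if h : 0 < t ∧ t < T then q (j, ⟨t - 1, by omega⟩) else if t = 0 then u j else v j

/-- The unnormalized density, with respect to Lebesgue measure on the interior values, of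
`n` non-intersecting Gaussian bridges from `u` to `v` staying strictly above `f` and
strictly below `g` at the interior times `1, …, T − 1`. -/
def bridgeWeight (n T : ℕ) (u v : Fin n → ℝ) (f g : ℕ → EReal)
    (q : Fin n × Fin (T - 1) → ℝ) : ℝ≥0∞ :=
  Set.indicator
    {q' : Fin n × Fin (T - 1) → ℝ | ∀ t : ℕ, 1 ≤ t → t ≤ T - 1 →
      (∀ j k : Fin n, j < k →
        assemblePath n T u v q' k t < assemblePath n T u v q' j t) ∧
      (∀ j : Fin n, f t < (assemblePath n T u v q' j t : EReal) ∧
        (assemblePath n T u v q' j t : EReal) < g t)}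
    (fun q' => ENNReal.ofReal (∏ j : Fin n, ∏ t ∈ Finset.range T,
      Real.exp (-(assemblePath n T u v q' j (t + 1) - assemblePath n T u v q' j t) ^ 2 / 2)))
    q

/-- The total mass of the unnormalized non-intersecting Gaussian bridge measure. -/
def bridgeZ (n T : ℕ) (u v : Fin n → ℝ) (f g : ℕ → EReal) : ℝ≥0∞ :=
  ∫⁻ q, bridgeWeight n T u v f g q

/-- The law `𝔊[u; v; f; g]` of `n` non-intersecting Gaussian bridges on `⟦0, T⟧`,
realized as a Borel probability measure on trajectories `Fin n → ℕ → ℝ`. -/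
def bridgeLaw (n T : ℕ) (u v : Fin n → ℝ) (f g : ℕ → EReal) :
    Measure (Fin n → ℕ → ℝ) :=
  Measure.map (assemblePath n T u v)
    ((bridgeZ n T u v f g)⁻¹ •
      (volume : Measure (Fin n × Fin (T - 1) → ℝ)).withDensity (bridgeWeight n T u v f g))

section Sampler

/-- Integration over `Fin (N + 1) → ℝ` splits off the first coordinate. -/
lemma lintegral_pi_fin_succ {N : ℕ} (ν : Measure ℝ) [SigmaFinite ν]
    {F : (Fin (N + 1) → ℝ) → ℝ≥0∞} (hF : Measurable F) :
    ∫⁻ x, F x ∂(Measure.pi fun _ => ν) =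
      ∫⁻ a, ∫⁻ x, F (Fin.cons a x) ∂(Measure.pi fun _ => ν) ∂ν := by
  have h := (measurePreserving_piFinSuccAbove (fun _ : Fin (N + 1) => ν) 0).symm
  rw [← h.lintegral_comp hF, lintegral_prod]
  · simp [MeasurableEquiv.piFinSuccAbove, Fin.consEquiv]
  · exact (hF.comp h.measurable).aemeasurable

lemma lintegral_pi_fin_zero (ν : Measure ℝ) (F : (Fin 0 → ℝ) → ℝ≥0∞) :
    ∫⁻ x, F x ∂(Measure.pi fun _ => ν) = F 0 := by
  rw [Measure.pi_of_empty (fun _ : Fin 0 => ν) 0, lintegral_dirac]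

lemma measurable_fin_cons {N : ℕ} :
    Measurable fun p : ℝ × (Fin N → ℝ) => (Fin.cons p.1 p.2 : Fin (N + 1) → ℝ) := by
  refine measurable_pi_lambda _ fun i => ?_
  refine Fin.cases ?_ (fun j => ?_) i
  · simpa using measurable_fst
  · exact (measurable_pi_apply j).comp measurable_snd

lemma measurable_fin_tail {N : ℕ} :
    Measurable (Fin.tail : (Fin (N + 1) → ℝ) → Fin N → ℝ) :=
  measurable_pi_iff.2 fun i => measurable_pi_apply i.succ

lemma ENNReal.add_le_add_of_mul_le_mul {a b c d : ℝ≥0∞} (hac : a ≤ c) (hbc : b ≤ c)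
    (h : a * b ≤ c * d) : a + b ≤ c + d := by
  rcases eq_or_ne c ⊤ with rfl | hc
  · simp
  rcases eq_or_ne d ⊤ with rfl | hd
  · simp
  lift c to NNReal using hc
  lift d to NNReal using hd
  lift a to NNReal using ne_top_of_le_ne_top ENNReal.coe_ne_top hac
  lift b to NNReal using ne_top_of_le_ne_top ENNReal.coe_ne_top hbc
  norm_cast at *
  rcases eq_or_ne c 0 with rfl | hc
  · simp only [nonpos_iff_eq_zero] at hac hbc
    simp [hac, hbc]
  have hc' : (0 : ℝ) < c := by positivity
  have h1 : (a : ℝ) ≤ c := hac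
  have h2 : (b : ℝ) ≤ c := hbc
  have h3 : (a : ℝ) * b ≤ c * d := by exact_mod_cast h
  have : (a : ℝ) + b ≤ c + d := by
    refine le_of_mul_le_mul_left ?_ hc'
    nlinarith [mul_nonneg (sub_nonneg.2 h1) (sub_nonneg.2 h2)]
  exact_mod_cast this

/-- The four functions theorem on the real line. -/
lemma four_functions_real (ν : Measure ℝ) {f₁ f₂ f₃ f₄ : ℝ → ℝ≥0∞}
    (h₁ : Measurable f₁) (h₂ : Measurable f₂) (h₃ : Measurable f₃) (h₄ : Measurable f₄)
    (h : ∀ x y, f₁ x * f₂ y ≤ f₃ (x ⊓ y) * f₄ (x ⊔ y)) :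
    (∫⁻ x, f₁ x ∂ν) * ∫⁻ x, f₂ x ∂ν ≤ (∫⁻ x, f₃ x ∂ν) * ∫⁻ x, f₄ x ∂ν := by
  have key : ∀ p q : ℝ → ℝ≥0∞, Measurable p → Measurable q →
      2 * ((∫⁻ x, p x ∂ν) * ∫⁻ x, q x ∂ν) =
        ∫⁻ x, ∫⁻ y, (p x * q y + q x * p y) ∂ν ∂ν := by
    intro p q hp hq
    have : ∀ x, ∫⁻ y, (p x * q y + q x * p y) ∂ν =
        p x * (∫⁻ y, q y ∂ν) + q x * ∫⁻ y, p y ∂ν := fun x => by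
      rw [lintegral_add_left (hq.const_mul _), lintegral_const_mul _ hq, lintegral_const_mul _ hp]
    simp_rw [this]
    rw [lintegral_add_left (hp.mul_const _), lintegral_mul_const _ hp, lintegral_mul_const _ hq]
    ring
  have main : ∀ x y, x ≤ y → f₁ x * f₂ y + f₂ x * f₁ y ≤ f₃ x * f₄ y + f₄ x * f₃ y := by
    intro x y hxy
    apply ENNReal.add_le_add_of_mul_le_mul
    · simpa [hxy] using h x y
    · simpa [hxy, mul_comm] using h y x
    · calc f₁ x * f₂ y * (f₂ x * f₁ y) = (f₁ x * f₂ x) * (f₁ y * f₂ y) := by ring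
        _ ≤ (f₃ x * f₄ x) * (f₃ y * f₄ y) := by
          exact mul_le_mul' (by simpa using h x x) (by simpa using h y y)
        _ = _ := by ring
  have two : 2 * ((∫⁻ x, f₁ x ∂ν) * ∫⁻ x, f₂ x ∂ν) ≤
      2 * ((∫⁻ x, f₃ x ∂ν) * ∫⁻ x, f₄ x ∂ν) := by
    rw [key _ _ h₁ h₂, key _ _ h₃ h₄]
    refine lintegral_mono fun x => lintegral_mono fun y => ?_
    rcases le_total x y with hxy | hxy
    · exact main x y hxy
    · simpa [add_comm, mul_comm] using main y x hxy
  exact (ENNReal.mul_le_mul_iff_right (by simp) (by simp)).1 two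

/-- The four functions theorem for Lebesgue measure on `Fin N → ℝ`. -/
lemma four_functions_pi {N : ℕ} {f₁ f₂ f₃ f₄ : (Fin N → ℝ) → ℝ≥0∞}
    (h₁ : Measurable f₁) (h₂ : Measurable f₂) (h₃ : Measurable f₃) (h₄ : Measurable f₄)
    (h : ∀ x y, f₁ x * f₂ y ≤ f₃ (x ⊓ y) * f₄ (x ⊔ y)) :
    (∫⁻ x, f₁ x) * ∫⁻ x, f₂ x ≤ (∫⁻ x, f₃ x) * ∫⁻ x, f₄ x := by
  induction N with
  | zero =>
    simpa only [volume_pi, lintegral_pi_fin_zero, inf_idem, sup_idem] using h 0 0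
  | succ N ih =>
    simp only [volume_pi]
    rw [lintegral_pi_fin_succ _ h₁, lintegral_pi_fin_succ _ h₂, lintegral_pi_fin_succ _ h₃,
      lintegral_pi_fin_succ _ h₄]
    have hm : ∀ {f : (Fin (N + 1) → ℝ) → ℝ≥0∞}, Measurable f → Measurable fun a : ℝ =>
        ∫⁻ x, f (Fin.cons a x) ∂(Measure.pi fun _ : Fin N => (volume : Measure ℝ)) :=
      fun hf => (hf.comp measurable_fin_cons).lintegral_prod_right'
    have hc : ∀ {f : (Fin (N + 1) → ℝ) → ℝ≥0∞}, Measurable f → ∀ a : ℝ, Measurable fun x =>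
        f (Fin.cons a x) :=
      fun hf a => hf.comp (measurable_fin_cons.comp measurable_prodMk_left)
    refine four_functions_real _ (hm h₁) (hm h₂) (hm h₃) (hm h₄) fun a a' => ?_
    refine ih (hc h₁ a) (hc h₂ a') (hc h₃ _) (hc h₄ _) fun x y => ?_
    convert h (Fin.cons a x) (Fin.cons a' y) using 3 <;>
    · ext i
      refine Fin.cases ?_ (fun j => ?_) i <;> simp

/-- The quantile function of a finite nonzero measure on `ℝ`, at level `s` relative to the
total mass. -/
def quantile (μ : Measure ℝ) (s : ℝ) : ℝ :=
  open Classical in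
  if (0 < s ∧ s < 1) ∧ μ univ ≠ 0 ∧ μ univ ≠ ⊤ then
    sInf {c : ℝ | ENNReal.ofReal s * μ univ ≤ μ (Iic c)} else 0

lemma quantile_le_iff {μ : Measure ℝ} {s : ℝ} (hs0 : 0 < s) (hs1 : s < 1)
    (h0 : μ univ ≠ 0) (htop : μ univ ≠ ⊤) (c : ℝ) :
    quantile μ s ≤ c ↔ ENNReal.ofReal s * μ univ ≤ μ (Iic c) := by
  have : IsFiniteMeasure μ := ⟨htop.lt_top⟩
  rw [quantile, if_pos ⟨⟨hs0, hs1⟩, h0, htop⟩]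
  set S := {c : ℝ | ENNReal.ofReal s * μ univ ≤ μ (Iic c)} with hS
  have hpos : 0 < ENNReal.ofReal s * μ univ :=
    ENNReal.mul_pos (by simpa using hs0) h0
  have hlt : ENNReal.ofReal s * μ univ < μ univ := by
    conv_rhs => rw [← one_mul (μ univ)]
    exact ENNReal.mul_lt_mul_left h0 htop (by simpa using hs1)
  have hne : S.Nonempty := by
    have := (tendsto_measure_Iic_atTop μ).eventually (lt_mem_nhds hlt)
    obtain ⟨c, hc⟩ := this.exists
    exact ⟨c, hc.le⟩
  have hbdd : BddBelow S := by
    have ht := tendsto_measure_iInter_atBot (μ := μ) (s := fun c : ℝ => Iic c)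
      (fun _ => measurableSet_Iic.nullMeasurableSet) (fun _ _ h => Iic_subset_Iic.2 h)
      ⟨0, measure_ne_top _ _⟩
    rw [iInter_Iic_eq_empty_iff.2 (by simp), measure_empty] at ht
    obtain ⟨c, hc⟩ := (ht.eventually (gt_mem_nhds hpos)).exists
    refine ⟨c, fun d hd => le_of_not_gt fun hdc => ?_⟩
    exact absurd (hd.trans (measure_mono (Iic_subset_Iic.2 hdc.le))) hc.not_ge
  constructor
  · intro hc
    have hgt : ∀ d, c < d → ENNReal.ofReal s * μ univ ≤ μ (Iic d) := fun d hd => by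
      obtain ⟨e, he, hed⟩ := exists_lt_of_csInf_lt hne (hc.trans_lt hd)
      exact le_trans he (measure_mono (Iic_subset_Iic.2 hed.le))
    have hInter : Iic c = ⋂ d > c, Iic d := by
      ext x
      simp only [mem_Iic, mem_iInter]
      exact ⟨fun h d hd => h.trans hd.le, fun h => le_of_forall_gt_imp_ge_of_dense h⟩
    have ht : Filter.Tendsto (fun d => μ (Iic d)) (nhdsWithin c (Ioi c)) (nhds (μ (Iic c))) := by
      rw [hInter]
      exact tendsto_measure_biInter_gt (fun _ _ => measurableSet_Iic.nullMeasurableSet)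
        (fun i j _ hij => Iic_subset_Iic.2 hij) ⟨c + 1, by simp, measure_ne_top _ _⟩
    exact ge_of_tendsto ht (eventually_mem_nhdsWithin.mono hgt)
  · exact fun hc => csInf_le hbdd hc

lemma measurable_quantile {Θ : Type*} [MeasurableSpace Θ] {μ : Θ → Measure ℝ}
    (hμ : Measurable μ) {s : Θ → ℝ} (hs : Measurable s) :
    Measurable fun θ => quantile (μ θ) (s θ) := by
  have hev : ∀ {A : Set ℝ}, MeasurableSet A → Measurable fun θ => μ θ A :=
    fun hA => (Measure.measurable_coe hA).comp hμ
  let G : Set Θ := {θ | (0 < s θ ∧ s θ < 1) ∧ μ θ univ ≠ 0 ∧ μ θ univ ≠ ⊤}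
  have hG : MeasurableSet G :=
    ((measurableSet_lt measurable_const hs).inter (measurableSet_lt hs measurable_const)).inter
      (((measurableSet_singleton (0 : ℝ≥0∞)).compl.preimage (hev .univ)).inter
        ((measurableSet_singleton (⊤ : ℝ≥0∞)).compl.preimage (hev .univ)))
  refine measurable_of_Iic fun c => ?_
  have : (fun θ => quantile (μ θ) (s θ)) ⁻¹' Iic c =
      (G ∩ {θ | ENNReal.ofReal (s θ) * μ θ univ ≤ μ θ (Iic c)}) ∪ (Gᶜ ∩ {_θ | 0 ≤ c}) := by
    ext θ
    by_cases hθ : θ ∈ G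
    · simp [hθ, quantile_le_iff hθ.1.1 hθ.1.2 hθ.2.1 hθ.2.2]
    · have : quantile (μ θ) (s θ) = 0 := if_neg hθ
      simp [hθ, this]
  rw [this]
  exact (hG.inter (measurableSet_le ((ENNReal.measurable_ofReal.comp hs).mul (hev .univ))
    (hev measurableSet_Iic))).union (hG.compl.inter (.const _))

lemma measurable_quantile_right (μ : Measure ℝ) : Measurable (quantile μ) :=
  measurable_quantile (measurable_const (a := μ)) measurable_id

/-- The uniform distribution on the unit interval. -/
def unif : Measure ℝ := volume.restrict (Ioo 0 1)

instance : IsProbabilityMeasure unif := ⟨by simp [unif]⟩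

lemma map_quantile {μ : Measure ℝ} (h0 : μ univ ≠ 0) (htop : μ univ ≠ ⊤) :
    μ univ • unif.map (quantile μ) = μ := by
  have : IsFiniteMeasure μ := ⟨htop.lt_top⟩
  have : IsFiniteMeasure (μ univ • unif.map (quantile μ)) :=
    Measure.smul_finite _ htop
  refine Measure.ext_of_Iic _ _ fun c => ?_
  have hq := measurable_quantile_right μ
  rw [Measure.smul_apply, Measure.map_apply hq measurableSet_Iic, unif,
    Measure.restrict_apply (hq measurableSet_Iic), smul_eq_mul]
  set p : ℝ≥0∞ := μ (Iic c) / μ univ with hp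
  have hp1 : p ≤ 1 := ENNReal.div_le_of_le_mul (by simpa using measure_mono (subset_univ _))
  have hpt : p ≠ ⊤ := ne_top_of_le_ne_top ENNReal.one_ne_top hp1
  have hp1' : p.toReal ≤ 1 := by simpa using ENNReal.toReal_mono ENNReal.one_ne_top hp1
  have hiff : ∀ s ∈ Ioo (0 : ℝ) 1, quantile μ s ≤ c ↔ s ≤ p.toReal := fun s hs => by
    rw [quantile_le_iff hs.1 hs.2 h0 htop, ← ENNReal.le_div_iff_mul_le (.inl h0) (.inl htop),
      ENNReal.ofReal_le_iff_le_toReal hpt]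
  have hv : volume (quantile μ ⁻¹' Iic c ∩ Ioo 0 1) = p := by
    rw [← ENNReal.ofReal_toReal hpt]
    apply le_antisymm
    · calc _ ≤ volume (Ioc 0 p.toReal) :=
            measure_mono fun s hs => ⟨hs.2.1, (hiff s hs.2).1 hs.1⟩
        _ = _ := by simp
    · calc _ = volume (Ioo 0 p.toReal) := by simp
        _ ≤ _ := by
          refine measure_mono fun s hs => ?_
          have h : s ∈ Ioo (0 : ℝ) 1 := ⟨hs.1, hs.2.trans_le hp1'⟩
          exact ⟨(hiff s h).2 hs.2.le, h⟩
  rw [hv, hp, ENNReal.mul_div_cancel h0 htop]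

/-- The density of the first coordinate under the density `w`. -/
def firstMarginal {N : ℕ} (w : (Fin (N + 1) → ℝ) → ℝ≥0∞) (a : ℝ) : ℝ≥0∞ :=
  ∫⁻ x : Fin N → ℝ, w (Fin.cons a x)

/-- The first coordinate, sampled from `w` by its quantile function. -/
def firstSample {N : ℕ} (w : (Fin (N + 1) → ℝ) → ℝ≥0∞) (s : ℝ) : ℝ :=
  quantile (volume.withDensity (firstMarginal w)) s

/-- The Knothe–Rosenblatt map: samples the coordinates successively from their conditional
distributions under the unnormalized density `w`, using quantile functions. -/
def sampler : (N : ℕ) → ((Fin N → ℝ) → ℝ≥0∞) → (Fin N → ℝ) → Fin N → ℝ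
  | 0, _, U => U
  | N + 1, w, U => Fin.cons (firstSample w (U 0))
      (sampler N (fun x => w (Fin.cons (firstSample w (U 0)) x)) (Fin.tail U))

variable {N : ℕ}

lemma measurable_comp_cons {Θ : Type*} [MeasurableSpace Θ] {w : Θ → (Fin (N + 1) → ℝ) → ℝ≥0∞}
    (hw : Measurable (Function.uncurry w)) :
    Measurable fun p : (Θ × ℝ) × (Fin N → ℝ) => w p.1.1 (Fin.cons p.1.2 p.2) :=
  hw.comp ((measurable_fst.comp measurable_fst).prodMk
    (measurable_fin_cons.comp ((measurable_snd.comp measurable_fst).prodMk measurable_snd)))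

lemma measurable_firstMarginal {w : (Fin (N + 1) → ℝ) → ℝ≥0∞} (hw : Measurable w) :
    Measurable (firstMarginal w) :=
  (hw.comp measurable_fin_cons).lintegral_prod_right'

lemma measurable_firstSample {Θ : Type*} [MeasurableSpace Θ]
    {w : Θ → (Fin (N + 1) → ℝ) → ℝ≥0∞} (hw : Measurable (Function.uncurry w)) :
    Measurable fun p : Θ × ℝ => firstSample (w p.1) p.2 := by
  have hm : Measurable fun p : Θ × ℝ => firstMarginal (w p.1) p.2 :=
    (measurable_comp_cons hw).lintegral_prod_right'
  refine measurable_quantile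
    (μ := fun p : Θ × ℝ => volume.withDensity (firstMarginal (w p.1))) ?_ measurable_snd
  refine Measure.measurable_of_measurable_coe _ fun A hA => ?_
  simp_rw [withDensity_apply _ hA]
  have : Measurable fun θ => ∫⁻ a in A, firstMarginal (w θ) a := hm.lintegral_prod_right'
  exact this.comp measurable_fst

lemma measurable_sampler {Θ : Type*} [MeasurableSpace Θ] {w : Θ → (Fin N → ℝ) → ℝ≥0∞}
    (hw : Measurable (Function.uncurry w)) :
    Measurable fun p : Θ × (Fin N → ℝ) => sampler N (w p.1) p.2 := by
  induction N generalizing Θ with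
  | zero => exact measurable_snd
  | succ N ih =>
    have h0 : Measurable fun p : Θ × (Fin (N + 1) → ℝ) => firstSample (w p.1) (p.2 0) :=
      (measurable_firstSample hw).comp (f := fun p : Θ × (Fin (N + 1) → ℝ) => (p.1, p.2 0))
        (by fun_prop)
    have ht : Measurable fun p : Θ × (Fin (N + 1) → ℝ) => Fin.tail p.2 :=
      measurable_fin_tail.comp measurable_snd
    have hrec := ih (w := fun (p : Θ × ℝ) x => w p.1 (Fin.cons p.2 x)) (measurable_comp_cons hw)
    exact measurable_fin_cons.comp
      (h0.prodMk (hrec.comp ((measurable_fst.prodMk h0).prodMk ht)))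

lemma measurable_sampler_right {w : (Fin N → ℝ) → ℝ≥0∞} (hw : Measurable w) :
    Measurable (sampler N w) :=
  (measurable_sampler (Θ := Unit) (w := fun _ => w) (hw.comp measurable_snd)).comp
    (measurable_prodMk_left (x := ()))

lemma withDensity_firstMarginal_univ {w : (Fin (N + 1) → ℝ) → ℝ≥0∞} (hw : Measurable w) :
    volume.withDensity (firstMarginal w) univ = ∫⁻ x, w x := by
  rw [withDensity_apply _ .univ, setLIntegral_univ, volume_pi, lintegral_pi_fin_succ _ hw]
  rfl

lemma lintegral_firstSample {w : (Fin (N + 1) → ℝ) → ℝ≥0∞} (hw : Measurable w)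
    (h0 : ∫⁻ x, w x ≠ 0) (htop : ∫⁻ x, w x ≠ ⊤) {H : ℝ → ℝ≥0∞} (hH : Measurable H) :
    (∫⁻ x, w x) * ∫⁻ s, H (firstSample w s) ∂unif = ∫⁻ a, firstMarginal w a * H a := by
  have huniv := withDensity_firstMarginal_univ hw
  have h := map_quantile (μ := volume.withDensity (firstMarginal w))
    (by rwa [huniv]) (by rwa [huniv])
  rw [huniv] at h
  have hmul := lintegral_withDensity_eq_lintegral_mul volume (measurable_firstMarginal hw) hH
  simp only [Pi.mul_apply] at hmul
  rw [← hmul]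
  conv_rhs => rw [← h]
  rw [lintegral_smul_measure, lintegral_map hH (measurable_quantile_right _), smul_eq_mul]
  rfl

lemma lintegral_sampler {w : (Fin N → ℝ) → ℝ≥0∞} (hw : Measurable w)
    (htop : ∫⁻ x, w x ≠ ⊤) {H : (Fin N → ℝ) → ℝ≥0∞} (hH : Measurable H) :
    (∫⁻ x, w x) * ∫⁻ U, H (sampler N w U) ∂(Measure.pi fun _ => unif) = ∫⁻ x, w x * H x := by
  induction N with
  | zero =>
    simp only [volume_pi, lintegral_pi_fin_zero]
    rfl
  | succ N ih =>
    rcases eq_or_ne (∫⁻ x, w x) 0 with h0 | h0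
    · rw [h0, zero_mul, eq_comm, lintegral_eq_zero_iff (by fun_prop)]
      filter_upwards [(lintegral_eq_zero_iff hw).1 h0] with x hx
      simp [show w x = 0 from hx]
    let K : ℝ → ℝ≥0∞ := fun a => ∫⁻ U, H (Fin.cons a (sampler N (fun x => w (Fin.cons a x)) U))
      ∂(Measure.pi fun _ => unif)
    have hK : Measurable K := by
      have := measurable_sampler (Θ := ℝ) (w := fun a x => w (Fin.cons a x))
        (hw.comp measurable_fin_cons)
      exact (hH.comp (measurable_fin_cons.comp
        (measurable_fst.prodMk this))).lintegral_prod_right'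
    have hsplit : ∫⁻ U, H (sampler (N + 1) w U) ∂(Measure.pi fun _ => unif) =
        ∫⁻ s, K (firstSample w s) ∂unif := by
      exact lintegral_pi_fin_succ _ (hH.comp (measurable_sampler_right hw))
    rw [hsplit, lintegral_firstSample hw h0 htop hK, volume_pi,
      lintegral_pi_fin_succ _ (F := fun x => w x * H x) (by fun_prop)]
    have hfin : ∀ᵐ a, firstMarginal w a < ⊤ := by
      refine ae_lt_top (measurable_firstMarginal hw) ?_
      rwa [← setLIntegral_univ, ← withDensity_apply _ .univ, withDensity_firstMarginal_univ hw]
    refine lintegral_congr_ae ?_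
    filter_upwards [hfin] with a ha
    have hc := measurable_fin_cons.comp (measurable_prodMk_left (x := a) (β := Fin N → ℝ))
    exact ih (hw.comp hc) ha.ne (hH.comp hc)

/-- The sampler pushes the uniform distribution to the normalized measure with density `w`. -/
lemma map_sampler {w : (Fin N → ℝ) → ℝ≥0∞} (hw : Measurable w)
    (h0 : ∫⁻ x, w x ≠ 0) (htop : ∫⁻ x, w x ≠ ⊤) :
    (Measure.pi fun _ => unif).map (sampler N w) =
      (∫⁻ x, w x)⁻¹ • volume.withDensity w := by
  refine Measure.ext_of_lintegral _ fun H hH => ?_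
  rw [lintegral_map hH (measurable_sampler_right hw), lintegral_smul_measure,
    lintegral_withDensity_eq_lintegral_mul _ hw hH]
  simp only [Pi.mul_apply, smul_eq_mul]
  rw [← lintegral_sampler hw htop hH, ← mul_assoc, ENNReal.inv_mul_cancel h0 htop, one_mul]

/-- The Holley condition for `w` to be stochastically dominated by the translate of `w'`
by `b`. -/
def Holley (w w' : (Fin N → ℝ) → ℝ≥0∞) (b : Fin N → ℝ) : Prop :=
  ∀ x y, w x * w' y ≤ w (x ⊓ (y + b)) * w' ((x - b) ⊔ y)

lemma Holley.cons_inf {a a' : ℝ} {x y b} :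
    (Fin.cons a x : Fin (N + 1) → ℝ) ⊓ (Fin.cons a' y + b) =
      Fin.cons (a ⊓ (a' + b 0)) (x ⊓ (y + Fin.tail b)) := by
  ext i
  refine Fin.cases ?_ (fun j => ?_) i <;> simp [Fin.tail]

lemma Holley.cons_sup {a a' : ℝ} {x y b} :
    ((Fin.cons a x : Fin (N + 1) → ℝ) - b) ⊔ Fin.cons a' y =
      Fin.cons ((a - b 0) ⊔ a') ((x - Fin.tail b) ⊔ y) := by
  ext i
  refine Fin.cases ?_ (fun j => ?_) i <;> simp [Fin.tail]

lemma Holley.conditional {w w' : (Fin (N + 1) → ℝ) → ℝ≥0∞} {b : Fin (N + 1) → ℝ}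
    (h : Holley w w' b) {a a' : ℝ} (ha : a ≤ a' + b 0) :
    Holley (fun x => w (Fin.cons a x)) (fun x => w' (Fin.cons a' x)) (Fin.tail b) := by
  intro x y
  have := h (Fin.cons a x) (Fin.cons a' y)
  rwa [cons_inf, cons_sup, inf_eq_left.2 ha, sup_eq_right.2 (by linarith)] at this

lemma Holley.firstMarginal {w w' : (Fin (N + 1) → ℝ) → ℝ≥0∞} {b : Fin (N + 1) → ℝ}
    (hw : Measurable w) (hw' : Measurable w') (h : Holley w w' b) (a a' : ℝ) :
    firstMarginal w a * firstMarginal w' a' ≤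
      firstMarginal w (a ⊓ (a' + b 0)) * firstMarginal w' ((a - b 0) ⊔ a') := by
  have hc : ∀ {f : (Fin (N + 1) → ℝ) → ℝ≥0∞}, Measurable f → ∀ a : ℝ, Measurable fun x =>
      f (Fin.cons a x) :=
    fun hf a => hf.comp (measurable_fin_cons.comp measurable_prodMk_left)
  have hs : ∀ a, ∫⁻ x, w' (Fin.cons a (x - Fin.tail b)) = _root_.firstMarginal w' a := fun a =>
    lintegral_sub_right_eq_self (fun x => w' (Fin.cons a x)) (Fin.tail b)
  rw [← hs, ← hs]
  refine four_functions_pi (hc hw a) ((hc hw' a').comp (measurable_sub_const _)) (hc hw _)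
    ((hc hw' _).comp (measurable_sub_const _)) fun x y => ?_
  have := h (Fin.cons a x) (Fin.cons a' (y - Fin.tail b))
  rw [cons_inf, cons_sup, sub_add_cancel] at this
  convert this using 4
  ext i
  simp [max_sub_sub_right]

lemma Holley.firstSample_le {w w' : (Fin (N + 1) → ℝ) → ℝ≥0∞} {b : Fin (N + 1) → ℝ}
    (hw : Measurable w) (hw' : Measurable w')
    (h0 : ∫⁻ x, w x ≠ 0) (htop : ∫⁻ x, w x ≠ ⊤)
    (h0' : ∫⁻ x, w' x ≠ 0) (htop' : ∫⁻ x, w' x ≠ ⊤)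
    (h : Holley w w' b) {s : ℝ} (hs : s ∈ Ioo (0 : ℝ) 1) :
    firstSample w s ≤ firstSample w' s + b 0 := by
  have hm := measurable_firstMarginal hw
  have hm' := measurable_firstMarginal hw'
  have hu := withDensity_firstMarginal_univ hw
  have hu' := withDensity_firstMarginal_univ hw'
  set c := firstSample w' s with hc
  have hq' := (quantile_le_iff hs.1 hs.2 (by rwa [hu']) (by rwa [hu']) c).1 hc.ge
  refine (quantile_le_iff hs.1 hs.2 (by rwa [hu]) (by rwa [hu]) _).2 ?_
  set Z := ∫⁻ x, w x
  set Z' := ∫⁻ x, w' x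
  have four : Z * volume.withDensity (_root_.firstMarginal w') (Iic c) ≤
      volume.withDensity (_root_.firstMarginal w) (Iic (c + b 0)) * Z' := by
    have e1 : volume.withDensity (_root_.firstMarginal w') (Iic c) =
        ∫⁻ y, (Iic c).indicator (_root_.firstMarginal w') (y - b 0) := by
      rw [lintegral_sub_right_eq_self (fun y => (Iic c).indicator (_root_.firstMarginal w') y),
        lintegral_indicator measurableSet_Iic, withDensity_apply _ measurableSet_Iic]
    have e2 : Z' = ∫⁻ y, _root_.firstMarginal w' (y - b 0) := by
      rw [lintegral_sub_right_eq_self (fun y => _root_.firstMarginal w' y), ← hu',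
        withDensity_apply _ .univ, setLIntegral_univ]
    rw [e1, e2, ← hu, withDensity_apply _ .univ, setLIntegral_univ,
      withDensity_apply _ measurableSet_Iic, ← lintegral_indicator measurableSet_Iic]
    refine four_functions_real _ hm
      ((hm'.indicator measurableSet_Iic).comp (measurable_sub_const _))
      (hm.indicator measurableSet_Iic) (hm'.comp (measurable_sub_const _)) fun x y => ?_
    by_cases hy : y - b 0 ≤ c
    · have hxy : x ⊓ y ∈ Iic (c + b 0) := inf_le_right.trans (sub_le_iff_le_add.1 hy)
      rw [indicator_of_mem (show y - b 0 ∈ Iic c from hy), indicator_of_mem hxy]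
      have := h.firstMarginal hw hw' x (y - b 0)
      rwa [sub_add_cancel, max_sub_sub_right] at this
    · rw [indicator_of_notMem (show y - b 0 ∉ Iic c from hy)]
      simp
  rw [hu'] at hq'
  rw [hu]
  refine (ENNReal.mul_le_mul_iff_left h0' htop').1 ?_
  calc _ = Z * (ENNReal.ofReal s * Z') := by ring
    _ ≤ _ := by gcongr
    _ ≤ _ := four

lemma ae_firstMarginal_firstSample {w : (Fin (N + 1) → ℝ) → ℝ≥0∞} (hw : Measurable w)
    (h0 : ∫⁻ x, w x ≠ 0) (htop : ∫⁻ x, w x ≠ ⊤) :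
    ∀ᵐ s ∂unif, firstMarginal w (firstSample w s) ≠ 0 ∧
      firstMarginal w (firstSample w s) ≠ ⊤ := by
  have hm := measurable_firstMarginal hw
  let A : Set ℝ := {a | firstMarginal w a ≠ 0 ∧ firstMarginal w a ≠ ⊤}
  have hA : MeasurableSet A := ((measurableSet_singleton (0 : ℝ≥0∞)).compl.preimage hm).inter
        ((measurableSet_singleton (⊤ : ℝ≥0∞)).compl.preimage hm)
  have hH : Measurable (Aᶜ.indicator (1 : ℝ → ℝ≥0∞)) := measurable_one.indicator hA.compl
  have h := lintegral_firstSample hw h0 htop hH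
  have hfin : ∀ᵐ a, firstMarginal w a < ⊤ := by
    refine ae_lt_top hm ?_
    rwa [← setLIntegral_univ, ← withDensity_apply _ .univ, withDensity_firstMarginal_univ hw]
  have hzero : ∫⁻ a, firstMarginal w a * Aᶜ.indicator 1 a = 0 := by
    rw [lintegral_eq_zero_iff (by fun_prop)]
    filter_upwards [hfin] with a ha
    by_cases haA : a ∈ A
    · simp [haA]
    · have : firstMarginal w a = 0 := by
        by_contra hne
        exact haA ⟨hne, ha.ne⟩
      simp [this]
  rw [hzero, mul_eq_zero, or_iff_right h0,
    lintegral_eq_zero_iff (f := fun s => Aᶜ.indicator 1 (firstSample w s))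
      (hH.comp (measurable_quantile_right _))] at h
  filter_upwards [h] with s hs
  by_contra hsA
  have : firstSample w s ∈ Aᶜ := hsA
  simp [this] at hs

/-- Under the Holley condition the samplers are ordered, up to the translation by `b`. -/
lemma Holley.sampler_le {w w' : (Fin N → ℝ) → ℝ≥0∞} {b : Fin N → ℝ}
    (hw : Measurable w) (hw' : Measurable w')
    (h0 : ∫⁻ x, w x ≠ 0) (htop : ∫⁻ x, w x ≠ ⊤)
    (h0' : ∫⁻ x, w' x ≠ 0) (htop' : ∫⁻ x, w' x ≠ ⊤) (h : Holley w w' b) :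
    ∀ᵐ U ∂(Measure.pi fun _ => unif), sampler N w U ≤ sampler N w' U + b := by
  induction N with
  | zero => exact .of_forall fun U i => i.elim0
  | succ N ih =>
    have hmeas : MeasurableSet {U | ¬ sampler (N + 1) w U ≤ sampler (N + 1) w' U + b} :=
      (measurableSet_le (measurable_sampler_right hw)
        ((measurable_sampler_right hw').add_const b)).compl
    rw [ae_iff, ← lintegral_indicator_one hmeas,
      lintegral_pi_fin_succ _ (measurable_one.indicator hmeas)]
    refine (lintegral_congr_ae ?_).trans lintegral_zero
    filter_upwards [ae_firstMarginal_firstSample hw h0 htop,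
      ae_firstMarginal_firstSample hw' h0' htop', ae_restrict_mem measurableSet_Ioo]
      with s hs hs' hs01
    have hc : ∀ a : ℝ, Measurable fun x : Fin N → ℝ => (Fin.cons a x : Fin (N + 1) → ℝ) :=
      fun a => measurable_fin_cons.comp measurable_prodMk_left
    have hle := h.firstSample_le hw hw' h0 htop h0' htop' hs01
    refine (lintegral_congr_ae ?_).trans lintegral_zero
    filter_upwards [ih (hw.comp (hc _)) (hw'.comp (hc _)) hs.1 hs.2 hs'.1 hs'.2
      (h.conditional hle)] with U hU
    refine indicator_of_notMem (not_not.2 fun i => ?_) _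
    refine Fin.cases ?_ (fun j => ?_) i
    · exact hle
    · exact hU j

/-- Two densities satisfying the Holley conditions in both directions, the second one up to a
translation by `b`, admit a coupling with `x ≤ x' ≤ x + b`. -/
lemma exists_coupling_of_holley {ι : Type*} [Fintype ι] {w w' : (ι → ℝ) → ℝ≥0∞}
    (hw : Measurable w) (hw' : Measurable w')
    (h0 : ∫⁻ x, w x ≠ 0) (htop : ∫⁻ x, w x ≠ ⊤)
    (h0' : ∫⁻ x, w' x ≠ 0) (htop' : ∫⁻ x, w' x ≠ ⊤) {b : ι → ℝ}
    (hle : ∀ x y, w x * w' y ≤ w (x ⊓ y) * w' (x ⊔ y))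
    (hle' : ∀ x y, w' x * w y ≤ w' (x ⊓ (y + b)) * w ((x - b) ⊔ y)) :
    ∃ γ : Measure ((ι → ℝ) × (ι → ℝ)), IsProbabilityMeasure γ ∧
      γ.map Prod.fst = (∫⁻ x, w x)⁻¹ • volume.withDensity w ∧
      γ.map Prod.snd = (∫⁻ x, w' x)⁻¹ • volume.withDensity w' ∧
      ∀ᵐ p ∂γ, p.1 ≤ p.2 ∧ p.2 ≤ p.1 + b := by
  let e := Fintype.equivFin ι
  let R : (Fin (Fintype.card ι) → ℝ) ≃ᵐ (ι → ℝ) :=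
    MeasurableEquiv.arrowCongr' e.symm (MeasurableEquiv.refl ℝ)
  have hR : MeasurePreserving R volume volume :=
    volume_preserving_arrowCongr' e.symm (MeasurableEquiv.refl ℝ) (.id _)
  have hRapp : ∀ z i, R z i = z (e i) := fun _ _ => rfl
  have hmass : ∀ {k : (ι → ℝ) → ℝ≥0∞}, Measurable k → ∫⁻ z, (k ∘ R) z = ∫⁻ x, k x :=
    fun hk => hR.lintegral_comp hk
  have hlaw : ∀ {k : (ι → ℝ) → ℝ≥0∞}, Measurable k → ∫⁻ x, k x ≠ 0 → ∫⁻ x, k x ≠ ⊤ →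
      (Measure.pi fun _ => unif).map (fun U => R (sampler _ (k ∘ R) U)) =
        (∫⁻ x, k x)⁻¹ • volume.withDensity k := by
    intro k hk hk0 hktop
    have hkR := hk.comp R.measurable
    have hS := measurable_sampler_right hkR
    rw [← Function.comp_def, ← Measure.map_map R.measurable hS, map_sampler hkR (by rwa [hmass hk]) (by rwa [hmass hk]), hmass hk, Measure.map_smul]
    congr 1
    refine Measure.ext_of_lintegral _ fun H hH => ?_
    rw [lintegral_map hH R.measurable, lintegral_withDensity_eq_lintegral_mul _ hk hH]
    exact (lintegral_withDensity_eq_lintegral_mul _ hkR (hH.comp R.measurable)).trans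
      (hR.lintegral_comp (hk.mul hH))
  have hΦ : ∀ {k : (ι → ℝ) → ℝ≥0∞}, Measurable k →
      Measurable fun U => R (sampler _ (k ∘ R) U) :=
    fun hk => R.measurable.comp (measurable_sampler_right (hk.comp R.measurable))
  have hΦ2 := (hΦ hw).prodMk (hΦ hw')
  refine ⟨(Measure.pi fun _ => unif).map fun U =>
    (R (sampler _ (w ∘ R) U), R (sampler _ (w' ∘ R) U)),
    Measure.isProbabilityMeasure_map hΦ2.aemeasurable, ?_, ?_, ?_⟩
  · rw [Measure.map_map measurable_fst hΦ2]
    exact hlaw hw h0 htop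
  · rw [Measure.map_map measurable_snd hΦ2]
    exact hlaw hw' h0' htop'
  · refine (ae_map_iff hΦ2.aemeasurable
      ((measurableSet_le measurable_fst measurable_snd).inter
        (measurableSet_le measurable_snd (measurable_fst.add_const b)))).2 ?_
    have H : Holley (w ∘ R) (w' ∘ R) 0 := fun x y => by
      have := hle (R x) (R y)
      rwa [add_zero, sub_zero]
    have H' : Holley (w' ∘ R) (w ∘ R) (b ∘ e.symm) := fun x y => by
      have hinf : R (x ⊓ (y + b ∘ e.symm)) = R x ⊓ (R y + b) := by
        ext i
        simp [hRapp]
      have hsup : R ((x - b ∘ e.symm) ⊔ y) = (R x - b) ⊔ R y := by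
        ext i
        simp [hRapp]
      simpa only [Function.comp_apply, hinf, hsup] using hle' (R x) (R y)
    filter_upwards [H.sampler_le (hw.comp R.measurable) (hw'.comp R.measurable)
        (by rwa [hmass hw]) (by rwa [hmass hw]) (by rwa [hmass hw']) (by rwa [hmass hw']),
      H'.sampler_le (hw'.comp R.measurable) (hw.comp R.measurable)
        (by rwa [hmass hw']) (by rwa [hmass hw']) (by rwa [hmass hw]) (by rwa [hmass hw])]
      with U hU hU'
    refine ⟨fun i => ?_, fun i => ?_⟩
    · simpa [hRapp] using hU (e i)
    · simpa [hRapp] using hU' (e i)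

end Sampler

section Bridge

variable {n T : ℕ}

lemma assemblePath_inf {u₁ v₁ u₂ v₂ : Fin n → ℝ} {c d : ℝ}
    (hu : ∀ j, u₁ j ≤ u₂ j + c) (hv : ∀ j, v₁ j ≤ v₂ j + (c + d * T))
    (x y : Fin n × Fin (T - 1) → ℝ) (j : Fin n) {t : ℕ} (ht : t ≤ T) :
    assemblePath n T u₁ v₁ (x ⊓ (y + fun p => c + d * ((p.2 : ℕ) + 1 : ℕ))) j t =
      min (assemblePath n T u₁ v₁ x j t) (assemblePath n T u₂ v₂ y j t + (c + d * t)) := by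
  unfold assemblePath
  split_ifs with h h0
  · have hcast : ((t - 1 : ℕ) : ℝ) + 1 = t := by exact_mod_cast Nat.sub_add_cancel h.1
    simp [hcast]
  · subst h0
    simpa using hu j
  · obtain rfl : t = T := by omega
    simpa using hv j

lemma assemblePath_sup {u₁ v₁ u₂ v₂ : Fin n → ℝ} {c d : ℝ}
    (hu : ∀ j, u₁ j ≤ u₂ j + c) (hv : ∀ j, v₁ j ≤ v₂ j + (c + d * T))
    (x y : Fin n × Fin (T - 1) → ℝ) (j : Fin n) {t : ℕ} (ht : t ≤ T) :
    assemblePath n T u₂ v₂ ((x - fun p => c + d * ((p.2 : ℕ) + 1 : ℕ)) ⊔ y) j t =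
      max (assemblePath n T u₁ v₁ x j t - (c + d * t)) (assemblePath n T u₂ v₂ y j t) := by
  unfold assemblePath
  split_ifs with h h0
  · have hcast : ((t - 1 : ℕ) : ℝ) + 1 = t := by exact_mod_cast Nat.sub_add_cancel h.1
    simp [hcast]
  · subst h0
    simpa using hu j
  · obtain rfl : t = T := by omega
    simpa using hv j

lemma sq_min_sub_add_sq_max_sub_le (a a' b b' : ℝ) :
    (min a' b' - min a b) ^ 2 + (max a' b' - max a b) ^ 2 ≤ (a' - a) ^ 2 + (b' - b) ^ 2 := by
  rcases le_total a b with h | h <;> rcases le_total a' b' with h' | h' <;>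
    simp only [h, h', min_eq_left, min_eq_right, max_eq_left, max_eq_right] <;>
    nlinarith [mul_nonneg (sub_nonneg.2 h) (sub_nonneg.2 h')]

/-- The Gaussian energy of a pair of paths does not increase when the first path and the
translate of the second path by the affine function `t ↦ c + d t` are replaced by their minimum
and maximum, provided these two are ordered at both ends. -/
lemma sum_sq_min_add_sum_sq_max_le (X Y : ℕ → ℝ) (c d : ℝ)
    (h0 : X 0 ≤ Y 0 + c) (hT : X T ≤ Y T + (c + d * T)) :
    ∑ t ∈ Finset.range T, ((min (X (t + 1)) (Y (t + 1) + (c + d * (t + 1 : ℕ))) -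
        min (X t) (Y t + (c + d * t))) ^ 2 +
      (max (X (t + 1) - (c + d * (t + 1 : ℕ))) (Y (t + 1)) -
        max (X t - (c + d * t)) (Y t)) ^ 2) ≤
    ∑ t ∈ Finset.range T, ((X (t + 1) - X t) ^ 2 + (Y (t + 1) - Y t) ^ 2) := by
  let M : ℕ → ℝ := fun t => max (X t - (c + d * t)) (Y t)
  have htel : ∑ t ∈ Finset.range T, ((M (t + 1) - M t) - (Y (t + 1) - Y t)) = 0 := by
    rw [Finset.sum_sub_distrib, Finset.sum_range_sub, Finset.sum_range_sub]
    have e0 : M 0 = Y 0 := max_eq_right (by simpa using h0)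
    have eT : M T = Y T := max_eq_right (by linarith)
    rw [e0, eT, sub_self]
  have hstep : ∀ t, (min (X (t + 1)) (Y (t + 1) + (c + d * (t + 1 : ℕ))) -
        min (X t) (Y t + (c + d * t))) ^ 2 + (M (t + 1) - M t) ^ 2 +
          2 * d * ((M (t + 1) - M t) - (Y (t + 1) - Y t)) ≤
      (X (t + 1) - X t) ^ 2 + (Y (t + 1) - Y t) ^ 2 := by
    intro t
    have hM : ∀ t, max (X t) (Y t + (c + d * t)) = M t + (c + d * t) := fun t => by
      simp [M, ← max_add_add_right]
    have := sq_min_sub_add_sq_max_sub_le (X t) (X (t + 1)) (Y t + (c + d * t))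
      (Y (t + 1) + (c + d * (t + 1 : ℕ)))
    rw [hM, hM] at this
    push_cast at this ⊢
    nlinarith
  have := Finset.sum_le_sum fun t (_ : t ∈ Finset.range T) => hstep t
  rw [Finset.sum_add_distrib, ← Finset.mul_sum, htel, mul_zero, add_zero] at this
  exact this

lemma measurable_assemblePath (u v : Fin n → ℝ) : Measurable (assemblePath n T u v) := by
  refine measurable_pi_lambda _ fun j => measurable_pi_lambda _ fun t => ?_
  unfold assemblePath
  split_ifs
  · exact measurable_pi_apply _
  · exact measurable_const
  · exact measurable_const

lemma measurable_assemblePath_apply (u v : Fin n → ℝ) (j : Fin n) (t : ℕ) :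
    Measurable fun q => assemblePath n T u v q j t :=
  measurable_pi_iff.1 (measurable_pi_iff.1 (measurable_assemblePath u v) j) t

lemma measurable_bridgeWeight (u v : Fin n → ℝ) (f g : ℕ → EReal) :
    Measurable (bridgeWeight n T u v f g) := by
  have hA := measurable_assemblePath_apply (T := T) u v
  refine Measurable.indicator (ENNReal.measurable_ofReal.comp ?_) ?_
  · refine Finset.measurable_prod _ fun j _ => Finset.measurable_prod _ fun t _ => ?_
    have h1 := hA j (t + 1)
    have h2 := hA j t
    fun_prop
  · simp only [ofPred_forall, ofPred_and]
    refine .iInter fun t => .iInter fun _ => .iInter fun _ => .inter ?_ ?_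
    · exact .iInter fun j => .iInter fun k => .iInter fun _ => measurableSet_lt (hA k t) (hA j t)
    · exact .iInter fun j => .inter
        (measurableSet_lt measurable_const (measurable_coe_real_ereal.comp (hA j t)))
        (measurableSet_lt (measurable_coe_real_ereal.comp (hA j t)) measurable_const)

/-- The Holley condition for bridge weights whose data are ordered up to an affine function
of time. -/
lemma bridgeWeight_holley {u₁ v₁ u₂ v₂ : Fin n → ℝ} {f₁ g₁ f₂ g₂ : ℕ → EReal} {c d : ℝ}
    (hu : ∀ j, u₁ j ≤ u₂ j + c) (hv : ∀ j, v₁ j ≤ v₂ j + (c + d * T))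
    (hf : ∀ t ≤ T, f₁ t ≤ f₂ t + ((c + d * t : ℝ) : EReal))
    (hg : ∀ t ≤ T, g₁ t ≤ g₂ t + ((c + d * t : ℝ) : EReal))
    (x y : Fin n × Fin (T - 1) → ℝ) :
    bridgeWeight n T u₁ v₁ f₁ g₁ x * bridgeWeight n T u₂ v₂ f₂ g₂ y ≤
      bridgeWeight n T u₁ v₁ f₁ g₁ (x ⊓ (y + fun p => c + d * ((p.2 : ℕ) + 1 : ℕ))) *
      bridgeWeight n T u₂ v₂ f₂ g₂ ((x - fun p => c + d * ((p.2 : ℕ) + 1 : ℕ)) ⊔ y) := by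
  have hinf := fun j t ht => assemblePath_inf hu hv x y j (t := t) ht
  have hsup := fun j t ht => assemblePath_sup hu hv x y j (t := t) ht
  set z := x ⊓ (y + fun p => c + d * ((p.2 : ℕ) + 1 : ℕ))
  set z' := (x - fun p => c + d * ((p.2 : ℕ) + 1 : ℕ)) ⊔ y
  unfold bridgeWeight
  by_cases hx : x ∈ {q' : Fin n × Fin (T - 1) → ℝ | ∀ t : ℕ, 1 ≤ t → t ≤ T - 1 →
      (∀ j k : Fin n, j < k →
        assemblePath n T u₁ v₁ q' k t < assemblePath n T u₁ v₁ q' j t) ∧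
      (∀ j : Fin n, f₁ t < (assemblePath n T u₁ v₁ q' j t : EReal) ∧
        (assemblePath n T u₁ v₁ q' j t : EReal) < g₁ t)}
  swap
  · rw [indicator_of_notMem hx, zero_mul]
    exact zero_le
  by_cases hy : y ∈ {q' : Fin n × Fin (T - 1) → ℝ | ∀ t : ℕ, 1 ≤ t → t ≤ T - 1 →
      (∀ j k : Fin n, j < k →
        assemblePath n T u₂ v₂ q' k t < assemblePath n T u₂ v₂ q' j t) ∧
      (∀ j : Fin n, f₂ t < (assemblePath n T u₂ v₂ q' j t : EReal) ∧
        (assemblePath n T u₂ v₂ q' j t : EReal) < g₂ t)}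
  swap
  · rw [indicator_of_notMem hy, mul_zero]
    exact zero_le
  have hadd : ∀ (a : EReal) (r s : ℝ), a < (r : EReal) → a + (s : EReal) < ((r + s : ℝ) : EReal) :=
    fun a r s h => by
      rw [EReal.coe_add]
      exact EReal.add_lt_add_right_coe h s
  rw [indicator_of_mem hx, indicator_of_mem hy, indicator_of_mem, indicator_of_mem,
    ← ENNReal.ofReal_mul (by positivity), ← ENNReal.ofReal_mul (by positivity)]
  · refine ENNReal.ofReal_le_ofReal ?_
    simp only [← Real.exp_sum, ← Real.exp_add, ← Finset.sum_add_distrib]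
    refine Real.exp_le_exp.2 (Finset.sum_le_sum fun j _ => ?_)
    have h0 : assemblePath n T u₁ v₁ x j 0 ≤ assemblePath n T u₂ v₂ y j 0 + c := by
      simpa [assemblePath] using hu j
    have hT : assemblePath n T u₁ v₁ x j T ≤ assemblePath n T u₂ v₂ y j T + (c + d * T) := by
      rcases Nat.eq_zero_or_pos T with rfl | hTpos
      · simpa using h0
      · simpa [assemblePath, hTpos.ne'] using hv j
    have := sum_sq_min_add_sum_sq_max_le _ _ c d h0 hT
    have e : ∀ X Y : ℕ → ℝ, ∑ t ∈ Finset.range T,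
        (-(X (t + 1) - X t) ^ 2 / 2 + -(Y (t + 1) - Y t) ^ 2 / 2) =
        -(∑ t ∈ Finset.range T, ((X (t + 1) - X t) ^ 2 + (Y (t + 1) - Y t) ^ 2)) / 2 := by
      intro X Y
      rw [neg_div, Finset.sum_div, ← Finset.sum_neg_distrib]
      exact Finset.sum_congr rfl fun t _ => by ring
    rw [e, e]
    have e' : ∑ t ∈ Finset.range T, ((assemblePath n T u₁ v₁ z j (t + 1) -
          assemblePath n T u₁ v₁ z j t) ^ 2 +
        (assemblePath n T u₂ v₂ z' j (t + 1) - assemblePath n T u₂ v₂ z' j t) ^ 2) ≤ _ :=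
      le_trans (le_of_eq (Finset.sum_congr rfl fun t ht => ?_)) this
    · linarith
    · have ht := Finset.mem_range.1 ht
      rw [hinf j _ ht, hinf j _ ht.le, hsup j _ ht, hsup j _ ht.le]
  · intro t h1 h2
    obtain ⟨hxo, hxb⟩ := hx t h1 h2
    obtain ⟨hyo, hyb⟩ := hy t h1 h2
    have htT : t ≤ T := by omega
    refine ⟨fun j k hjk => ?_, fun j => ?_⟩
    · rw [hsup k t htT, hsup j t htT]
      exact max_lt_max (sub_lt_sub_right (hxo j k hjk) _) (hyo j k hjk)
    · rw [hsup j t htT]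
      refine ⟨(hyb j).1.trans_le (EReal.coe_le_coe_iff.2 (le_max_right _ _)), ?_⟩
      rcases max_choice (assemblePath n T u₁ v₁ x j t - (c + d * t))
        (assemblePath n T u₂ v₂ y j t) with h | h <;> rw [h]
      · by_contra hcon
        have h3 : g₂ t + ((c + d * t : ℝ) : EReal) ≤
            ((assemblePath n T u₁ v₁ x j t - (c + d * t) : ℝ) : EReal) +
              ((c + d * t : ℝ) : EReal) := by
          gcongr
          exact not_lt.1 hcon
        rw [← EReal.coe_add, sub_add_cancel] at h3
        exact absurd ((hxb j).2.trans_le ((hg t htT).trans h3)) (lt_irrefl _)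
      · exact (hyb j).2
  · intro t h1 h2
    obtain ⟨hxo, hxb⟩ := hx t h1 h2
    obtain ⟨hyo, hyb⟩ := hy t h1 h2
    have htT : t ≤ T := by omega
    refine ⟨fun j k hjk => ?_, fun j => ?_⟩
    · rw [hinf k t htT, hinf j t htT]
      have := hyo j k hjk
      exact min_lt_min (hxo j k hjk) (by linarith)
    · rw [hinf j t htT]
      refine ⟨?_, (EReal.coe_le_coe_iff.2 (min_le_left _ _)).trans_lt (hxb j).2⟩
      rcases min_choice (assemblePath n T u₁ v₁ x j t)
        (assemblePath n T u₂ v₂ y j t + (c + d * t)) with h | h <;> rw [h]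
      · exact (hxb j).1
      · exact (hf t htT).trans_lt (hadd _ _ _ (hyb j).1)

/-- The monotone coupling of two bridge ensembles whose data differ by at most an affine function
of time. -/
lemma exists_bridge_coupling {u u' v v' : Fin n → ℝ} {f f' g g' : ℕ → EReal} {c d : ℝ}
    (hZ : 0 < bridgeZ n T u v f g ∧ bridgeZ n T u v f g < ⊤)
    (hZ' : 0 < bridgeZ n T u' v' f' g' ∧ bridgeZ n T u' v' f' g' < ⊤)
    (hu : ∀ j, u j ≤ u' j ∧ u' j ≤ u j + c) (hv : ∀ j, v j ≤ v' j ∧ v' j ≤ v j + (c + d * T))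
    (hfg : ∀ t ≤ T, f t ≤ f' t ∧ f' t ≤ f t + ((c + d * t : ℝ) : EReal) ∧
      g t ≤ g' t ∧ g' t ≤ g t + ((c + d * t : ℝ) : EReal)) :
    ∃ γ : Measure ((Fin n → ℕ → ℝ) × (Fin n → ℕ → ℝ)),
      IsProbabilityMeasure γ ∧
      γ.map Prod.fst = bridgeLaw n T u v f g ∧
      γ.map Prod.snd = bridgeLaw n T u' v' f' g' ∧
      γ {x | ∀ (j : Fin n) (t : ℕ), t ≤ T →
        x.1 j t ≤ x.2 j t ∧ x.2 j t ≤ x.1 j t + (c + d * t)} = 1 := by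
  have hle : ∀ x y, bridgeWeight n T u v f g x * bridgeWeight n T u' v' f' g' y ≤
      bridgeWeight n T u v f g (x ⊓ y) * bridgeWeight n T u' v' f' g' (x ⊔ y) := by
    intro x y
    have := bridgeWeight_holley (T := T) (c := 0) (d := 0) (u₁ := u) (u₂ := u') (v₁ := v)
      (v₂ := v') (f₁ := f) (f₂ := f') (g₁ := g) (g₂ := g') (by simpa using fun j => (hu j).1)
      (by simpa using fun j => (hv j).1) (by simpa using fun t ht => (hfg t ht).1)
      (by simpa using fun t ht => (hfg t ht).2.2.1) x y
    have hz : (fun p : Fin n × Fin (T - 1) => (0 : ℝ) + 0 * ((p.2 : ℕ) + 1 : ℕ)) = 0 := by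
      ext p
      simp
    rwa [hz, add_zero, sub_zero] at this
  have hle' := bridgeWeight_holley (T := T) (fun j => (hu j).2) (fun j => (hv j).2)
    (fun t ht => (hfg t ht).2.1) (fun t ht => (hfg t ht).2.2.2)
  obtain ⟨γ, hγ, hfst, hsnd, hae⟩ := exists_coupling_of_holley
    (measurable_bridgeWeight u v f g) (measurable_bridgeWeight u' v' f' g')
    hZ.1.ne' hZ.2.ne hZ'.1.ne' hZ'.2.ne hle hle'
  have hA := measurable_assemblePath (T := T) u v
  have hA' := measurable_assemblePath (T := T) u' v'
  have hP := hA.prodMap hA'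
  have hprob : IsProbabilityMeasure (γ.map (Prod.map (assemblePath n T u v)
      (assemblePath n T u' v'))) := Measure.isProbabilityMeasure_map hP.aemeasurable
  refine ⟨γ.map (Prod.map (assemblePath n T u v) (assemblePath n T u' v')), hprob, ?_, ?_, ?_⟩
  · rw [bridgeLaw, bridgeZ, ← hfst, Measure.map_map measurable_fst hP,
      Measure.map_map hA measurable_fst]
    rfl
  · rw [bridgeLaw, bridgeZ, ← hsnd, Measure.map_map measurable_snd hP,
      Measure.map_map hA' measurable_snd]
    rfl
  · have hmeas : MeasurableSet {x : (Fin n → ℕ → ℝ) × (Fin n → ℕ → ℝ) | ∀ (j : Fin n) (t : ℕ),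
        t ≤ T → x.1 j t ≤ x.2 j t ∧ x.2 j t ≤ x.1 j t + (c + d * t)} := by
      simp only [ofPred_forall, ofPred_and]
      refine .iInter fun j => .iInter fun t => .iInter fun _ => .inter ?_ ?_
      · exact measurableSet_le (by fun_prop) (by fun_prop)
      · exact measurableSet_le (by fun_prop) (by fun_prop)
    refine (mem_ae_iff_prob_eq_one hmeas).1 ?_
    refine (ae_map_iff hP.aemeasurable hmeas).2 ?_
    filter_upwards [hae] with p hp j t ht
    simp only [Prod.map_fst, Prod.map_snd]
    unfold assemblePath
    split_ifs with h h0
    · refine ⟨hp.1 _, (hp.2 _).trans_eq ?_⟩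
      have hcast : ((t - 1 : ℕ) : ℝ) + 1 = t := by exact_mod_cast Nat.sub_add_cancel h.1
      simp [hcast]
    · subst h0
      simpa using hu j
    · obtain rfl : t = T := by omega
      exact hv j

end Bridge

/-- Monotone couplings of non-intersecting Gaussian bridge ensembles. -/
theorem statement19 (T n : ℕ) (hT : 1 ≤ T) (hn : 1 ≤ n) (B : ℝ) (hB : 0 ≤ B)
    (u u' v v' : Fin n → ℝ)
    (hu : ∀ i j : Fin n, i < j → u j < u i) (hu' : ∀ i j : Fin n, i < j → u' j < u' i)
    (hv : ∀ i j : Fin n, i < j → v j < v i) (hv' : ∀ i j : Fin n, i < j → v' j < v' i)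
    (f f' g g' : ℕ → EReal)
    (hfg : ∀ t ≤ T, f t ≤ g t) (hfg' : ∀ t ≤ T, f' t ≤ g' t)
    (hZ : 0 < bridgeZ n T u v f g ∧ bridgeZ n T u v f g < ⊤)
    (hZ' : 0 < bridgeZ n T u' v' f' g' ∧ bridgeZ n T u' v' f' g' < ⊤)
    (huu : ∀ j : Fin n, u j ≤ u' j ∧ u' j ≤ u j + B)
    (hvv : ∀ j : Fin n, v j ≤ v' j ∧ v' j ≤ v j + B) :
    ((∀ t ≤ T, f t ≤ f' t ∧ f' t ≤ f t + (B : EReal) ∧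
        g t ≤ g' t ∧ g' t ≤ g t + (B : EReal)) →
      ∃ γ : Measure ((Fin n → ℕ → ℝ) × (Fin n → ℕ → ℝ)),
        IsProbabilityMeasure γ ∧
        γ.map Prod.fst = bridgeLaw n T u v f g ∧
        γ.map Prod.snd = bridgeLaw n T u' v' f' g' ∧
        γ {x | ∀ (j : Fin n) (t : ℕ), t ≤ T →
          x.1 j t ≤ x.2 j t ∧ x.2 j t ≤ x.1 j t + B} = 1) ∧
    (u = u' →
      (∀ t ≤ T, f t ≤ f' t ∧ f' t ≤ f t + (((t : ℝ) * B / (T : ℝ) : ℝ) : EReal) ∧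
        g t ≤ g' t ∧ g' t ≤ g t + (((t : ℝ) * B / (T : ℝ) : ℝ) : EReal)) →
      ∃ γ : Measure ((Fin n → ℕ → ℝ) × (Fin n → ℕ → ℝ)),
        IsProbabilityMeasure γ ∧
        γ.map Prod.fst = bridgeLaw n T u v f g ∧
        γ.map Prod.snd = bridgeLaw n T u' v' f' g' ∧
        γ {x | ∀ (j : Fin n) (t : ℕ), t ≤ T →
          x.1 j t ≤ x.2 j t ∧ x.2 j t ≤ x.1 j t + (t : ℝ) * B / (T : ℝ)} = 1) := by
  constructor
  · intro h
    simpa using exists_bridge_coupling (c := B) (d := 0) hZ hZ' huu (by simpa using hvv)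
      (by simpa using h)
  · rintro rfl h
    have hT0 : (T : ℝ) ≠ 0 := by positivity
    have e : ∀ t : ℝ, 0 + B / T * t = t * B / T := fun t => by ring
    have key := exists_bridge_coupling (c := 0) (d := B / T) hZ hZ' (fun j => by simp)
      (by simpa [e, mul_div_cancel_left₀ B hT0] using hvv) (by simpa only [e] using h)
    simpa only [e] using key
end
end
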